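/- Let Γ be a countable non-abelian free group, and equip Sub(Γ) with the σ-algebra generated by the sets {H : γ ∈ H}, γ ∈ Γ. Then there exists a family (μ_t)_{t ∈ [0,1]} of probability measures on Sub(Γ) such that: (1) for every t, each conjugation map H ↦ γHγ⁻¹ is nonsingular for μ_t; (2) for every t, each conjugation map is conservative for μ_t, i.e., for every γ ∈ Γ and every measurable B with μ_t(B) > 0 there exists n ≥ 1 such that μ_t({H ∈ B : γⁿHγ⁻ⁿ ∈ B}) > 0; (3) for every t, the conjugation action is ergodic for μ_t, i.e., every measurable set B with γBγ⁻¹ = B up to μ_t-null sets for all γ ∈ Γ satisfies μ_t(B) ∈ {0, 1}; (4) for every t, μ_t-almost every H ∈ Sub(Γ) is core-free, co-amenable and co-highly transitive; (5) each μ_t is mutually singular with every conjugation-invariant probability measure on Sub(Γ); and (6) the measures μ_t are pairwise mutually singular. -/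

import Mathlib

open MeasureTheory Filter Set
open scoped ENNReal symmDiff

variable {Λ : Type*} [Group Λ]

/-- The σ-algebra on `Sub(Λ)` generated by the sets `{H : γ ∈ H}`, `γ ∈ Λ`. -/
instance subgroupMeasurableSpace : MeasurableSpace (Subgroup Λ) :=
  MeasurableSpace.generateFrom {S | ∃ γ : Λ, S = {H : Subgroup Λ | γ ∈ H}}

/-- The conjugation map `H ↦ γHγ⁻¹` on subgroups. -/
def conjSubgroup (γ : Λ) (H : Subgroup Λ) : Subgroup Λ :=
  H.map (MulAut.conj γ).toMonoidHom

/-- `H` is core-free: its normal core `⋂ γ, γHγ⁻¹` is trivial. -/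
def IsCoreFree (H : Subgroup Λ) : Prop :=
  ∀ h : Λ, (∀ γ : Λ, γ⁻¹ * h * γ ∈ H) → h = 1

/-- `H` is co-amenable: the left action of `Λ` on `Λ/H` is amenable in the sense of
Greenleaf, i.e. admits `(F, ε)`-Følner sets for every finite `F ⊆ Λ` and every `ε > 0`. -/
def IsCoAmenable (H : Subgroup Λ) : Prop :=
  ∀ F : Finset Λ, ∀ ε : ℝ, 0 < ε →
    ∃ A : Set (Λ ⧸ H), A.Finite ∧ A.Nonempty ∧
      ∀ γ ∈ F, ((((γ • ·) '' A) ∆ A).ncard : ℝ) < ε * A.ncard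

/-- `H` is co-highly transitive: for every `k ≥ 1`, the action of `Λ` on `Λ/H` is
transitive on ordered `k`-tuples of pairwise distinct points. -/
def IsCoHighlyTransitive (H : Subgroup Λ) : Prop :=
  ∀ k : ℕ, 1 ≤ k → ∀ x y : Fin k → Λ ⧸ H, Function.Injective x → Function.Injective y →
    ∃ γ : Λ, ∀ i, γ • x i = y i

namespace ExoticECRS

/-- The elements of the free group represented by the suffixes of a word. -/
def suffixSet {ι : Type*} (l : List (ι × Bool)) : Set (FreeGroup ι) :=
  {g | ∃ l', l' <:+ l ∧ FreeGroup.mk l' = g}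

theorem finite_suffixSet {ι : Type*} (l : List (ι × Bool)) : (suffixSet l).Finite := by
  have : suffixSet l = FreeGroup.mk '' {l' | l' ∈ l.tails} := by
    ext g
    simp [suffixSet, List.mem_tails]
  rw [this]
  exact (List.finite_toSet _).image _

theorem one_mem_suffixSet {ι : Type*} (l : List (ι × Bool)) : (1 : FreeGroup ι) ∈ suffixSet l :=
  ⟨[], List.nil_suffix, FreeGroup.one_eq_mk.symm⟩

/-- Left multiplication by `c` on a finite subset of a group, wherever it is defined, extends to
a permutation of that subset. -/
theorem exists_perm_extending_mul {G : Type*} [Group G] (S : Set G) (hS : S.Finite) (c : G) :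
    ∃ π : Equiv.Perm S, ∀ s : S, ∀ h : c * s ∈ S, π s = ⟨c * s, h⟩ := by
  classical
  have : Finite S := hS
  let e : {s : S // c * s ∈ S} ≃ {s : S // c⁻¹ * s ∈ S} :=
    { toFun := fun s => ⟨⟨c * s.1, s.2⟩, by simp⟩
      invFun := fun s => ⟨⟨c⁻¹ * s.1, s.2⟩, by simp⟩
      left_inv := fun s => by simp
      right_inv := fun s => by simp }
  refine ⟨e.extendSubtype, fun s h => ?_⟩
  rw [Equiv.extendSubtype_apply_of_mem e s h]
  rfl

/-- In a finite subset of a free group containing `1`, the powers of a generator eventually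
leave the set. -/
theorem exists_last_power {ι : Type*} (S : Set (FreeGroup ι)) (hS : S.Finite)
    (h1 : (1 : FreeGroup ι) ∈ S) (b : ι) :
    ∃ k : ℕ, FreeGroup.of b ^ k ∈ S ∧ FreeGroup.of b ^ (k + 1) ∉ S := by
  classical
  have hex : ∃ k : ℕ, FreeGroup.of b ^ k ∉ S := by
    by_contra! h
    have hinj : Function.Injective fun k : ℕ => FreeGroup.of b ^ k := by
      intro i j hij
      have := congrArg (FreeGroup.lift fun _ => Multiplicative.ofAdd (1 : ℤ)) hij
      simpa [← ofAdd_nsmul] using this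
    exact Set.infinite_of_injective_forall_mem hinj h hS
  obtain ⟨k, hk⟩ : ∃ k, Nat.find hex = k + 1 := by
    refine Nat.exists_eq_succ_of_ne_zero fun h => ?_
    have := Nat.find_spec hex
    rw [h] at this
    exact this (by simpa using h1)
  refine ⟨k, ?_, hk ▸ Nat.find_spec hex⟩
  by_contra h
  have := Nat.find_min' hex h
  omega

/-- The data from which the Schreier graphs are assembled: two distinct generators, an
enumeration of all words, for each word a finite permutation action on its suffixes extending
left multiplication, and a fast growing sequence of sizes. -/
structure Data (ι : Type*) where
  a : ι
  b : ι
  a_ne_b : a ≠ b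
  w : ℕ → List (ι × Bool)
  w_surj : Function.Surjective w
  σ : ι → ∀ n, Equiv.Perm (suffixSet (w n))
  σ_apply : ∀ i n (s : suffixSet (w n)) (h : FreeGroup.of i * (s : FreeGroup ι) ∈ suffixSet (w n)),
    σ i n s = ⟨FreeGroup.of i * s, h⟩
  z : ∀ n, suffixSet (w n)
  z_last : ∀ n, FreeGroup.of b * (z n : FreeGroup ι) ∉ suffixSet (w n)
  L : ℕ → ℕ
  L_large : ∀ n, 100 * (n + 1) ^ 3 ≤ L n
  L_dvd : ∀ n, 4 * L n ∣ L (n + 1)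
  σ_pow : ∀ n, σ a n ^ L (n + 1) = 1

theorem nonempty_data {ι : Type*} [Countable ι] [Nontrivial ι] : Nonempty (Data ι) := by
  classical
  obtain ⟨a, b, hab⟩ := exists_pair_ne ι
  obtain ⟨w, hw⟩ := exists_surjective_nat (List (ι × Bool))
  have hfin (n) : Finite (suffixSet (w n)) := finite_suffixSet _
  choose σ hσ using fun (i : ι) (n : ℕ) =>
    exists_perm_extending_mul (suffixSet (w n)) (finite_suffixSet _) (FreeGroup.of i)
  choose k hk hk' using fun n =>
    exists_last_power (suffixSet (w n)) (finite_suffixSet _) (one_mem_suffixSet _) b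
  let o : ℕ → ℕ := fun n => Nat.card (Equiv.Perm (suffixSet (w n)))
  have ho : ∀ n, 0 < o n := fun n => Nat.card_pos
  let L : ℕ → ℕ := fun n =>
    Nat.rec 100 (fun n l => 4 * l * (o n * (100 * (n + 2) ^ 3))) n
  have hL : ∀ n, L (n + 1) = 4 * L n * (o n * (100 * (n + 2) ^ 3)) := fun n => rfl
  have hLpos : ∀ n, 0 < L n := by
    intro n
    induction n with
    | zero => simp [L]
    | succ n ih => rw [hL]; have := ho n; positivity
  refine ⟨⟨a, b, hab, w, hw, σ, hσ, fun n => ⟨_, hk n⟩, fun n => ?_,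
    L, fun n => ?_, fun n => ⟨_, hL n⟩, fun n => ?_⟩⟩
  · have := hk' n
    rwa [pow_succ'] at this
  · cases n with
    | zero => simp [L]
    | succ n =>
      rw [hL]
      have h1 := hLpos n
      have h2 := ho n
      have : 1 ≤ 4 * L n * o n := by
        have : 0 < 4 * L n * o n := by positivity
        omega
      calc 100 * (n + 1 + 1) ^ 3 = 1 * (100 * (n + 2) ^ 3) := by ring
        _ ≤ (4 * L n * o n) * (100 * (n + 2) ^ 3) := Nat.mul_le_mul_right _ this
        _ = _ := by ring
  · have : L (n + 1) = o n * (4 * L n * (100 * (n + 2) ^ 3)) := by rw [hL]; ring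
    rw [this, pow_mul]
    simp [o]

namespace Data

variable {ι : Type*} (D : Data ι) (κ : ℕ → Bool)

theorem L_pos (n : ℕ) : 0 < D.L n :=
  lt_of_lt_of_le (by positivity) (D.L_large n)

instance (n : ℕ) : NeZero (4 * D.L n) := ⟨by have := D.L_pos n; omega⟩

instance (n : ℕ) : Finite (suffixSet (D.w n)) := finite_suffixSet _

/-- The `n`-th torus, on which the two distinguished generators act by translations. -/
abbrev Torus (n : ℕ) := ZMod (4 * D.L n) × ZMod (4 * D.L n)

/-- Reduction of an integer vector to a torus. -/
def vec (n : ℕ) (p : ℤ × ℤ) : D.Torus n := ((p.1 : ZMod (4 * D.L n)), (p.2 : ZMod (4 * D.L n)))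

theorem vec_add (n : ℕ) (p q : ℤ × ℤ) : D.vec n (p + q) = D.vec n p + D.vec n q := by
  simp [vec]

theorem vec_neg (n : ℕ) (p : ℤ × ℤ) : D.vec n (-p) = -D.vec n p := by
  simp [vec]

theorem vec_sub (n : ℕ) (p q : ℤ × ℤ) : D.vec n (p - q) = D.vec n p - D.vec n q := by
  simp [vec]

theorem vec_zero (n : ℕ) : D.vec n 0 = 0 := by
  simp [vec]

theorem vec_eq_iff {n : ℕ} {p q : ℤ × ℤ} :
    D.vec n p = D.vec n q ↔ (4 * D.L n : ℤ) ∣ q.1 - p.1 ∧ (4 * D.L n : ℤ) ∣ q.2 - p.2 := by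
  simp [vec, Prod.ext_iff, ZMod.intCast_eq_intCast_iff_dvd_sub]

theorem exists_vec (n : ℕ) (q : D.Torus n) : ∃ p, D.vec n p = q :=
  ⟨(q.1.cast, q.2.cast), by simp [vec]⟩

/-- The underlying set of the action: tori, finite pieces carrying partial translation actions,
and connecting points. -/
inductive Pt
  | T (n : ℕ) (q : D.Torus n)
  | Q (n : ℕ) (s : suffixSet (D.w n))
  | e (n : ℕ)

open Pt

variable {D}

/-- The index of the piece to which a point belongs. -/
def Pt.lev : D.Pt → ℕ
  | T n _ => n
  | Q n _ => n
  | e n => n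

variable (D)

/-- The integer multiple determining the position of the device of the `n`-th torus. -/
def mult (n : ℕ) : ℤ := if κ n then 3 else 2

/-- The first point of the device of the `n`-th torus. -/
def devZ (n : ℕ) : ℤ × ℤ := (mult κ n * D.L n, 0)

/-- The point through which the `n`-th torus is connected to later pieces. -/
def outZ (n : ℕ) : ℤ × ℤ := (4 * (n + 1), (4 * (n + 1)) ^ 2)

/-- The points of a torus other than the outgoing one at which the action is not a translation. -/
def baseZ (n : ℕ) : Set (ℤ × ℤ) := {0, D.devZ κ n, D.devZ κ n + (0, 1)}

/-- The first point of the device. -/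
def dev (n : ℕ) : D.Torus n := D.vec n (D.devZ κ n)

/-- The second point of the device. -/
def dev' (n : ℕ) : D.Torus n := D.vec n (D.devZ κ n + (0, 1))

/-- The outgoing point. -/
def out (n : ℕ) : D.Torus n := D.vec n (outZ n)

/-- The image of the origin of a torus under the gluing permutation. -/
def prevOut : ℕ → D.Pt
  | 0 => T 0 0
  | n + 1 => T n (D.out n)

/-- The preimage of the origin of a torus under the gluing permutation. -/
def prevEnd : ℕ → D.Pt
  | 0 => T 0 0
  | n + 1 => e n

open Classical in
/-- The gluing permutation, as a function. -/
noncomputable def tauFun : D.Pt → D.Pt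
  | T n q => if q = D.out n then Q n (D.z n) else if q = D.dev κ n then T n (D.dev' κ n)
      else if q = D.dev' κ n then T n (D.dev κ n) else if q = 0 then D.prevOut n else T n q
  | Q n s => if s = D.z n then e n else Q n s
  | e n => T (n + 1) 0

open Classical in
/-- The inverse of the gluing permutation, as a function. -/
noncomputable def tauInv : D.Pt → D.Pt
  | T n q => if q = D.out n then T (n + 1) 0 else if q = D.dev κ n then T n (D.dev' κ n)
      else if q = D.dev' κ n then T n (D.dev κ n) else if q = 0 then D.prevEnd n else T n q
  | Q n s => if s = D.z n then T n (D.out n) else Q n s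
  | e n => Q n (D.z n)

theorem small_of_dvd {n : ℕ} {x : ℤ} (h : (4 * D.L n : ℤ) ∣ x) (hx : |x| < 4 * D.L n) : x = 0 :=
  Int.eq_zero_of_abs_lt_dvd h hx

theorem large (n : ℕ) : (100 * (n + 1) ^ 3 : ℤ) ≤ D.L n := by
  exact_mod_cast D.L_large n

theorem mult_cases (n : ℕ) : mult κ n = 2 ∨ mult κ n = 3 := by
  unfold mult; split_ifs <;> simp

/-- Vectors in the rows near the origin are not outgoing. -/
theorem vec_ne_out (n : ℕ) (x y : ℤ) (hy : |y| ≤ 3) : D.vec n (x, y) ≠ D.out n := by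
  intro h
  have h2 := (D.vec_eq_iff.1 h).2
  have hl := D.large n
  have hn : (0 : ℤ) ≤ n := by positivity
  have := D.small_of_dvd h2 (by
    simp only [outZ]
    rw [abs_le] at hy
    rw [abs_lt]
    constructor <;> nlinarith [mul_nonneg hn hn, mul_nonneg hn (mul_nonneg hn hn)])
  simp only [outZ] at this
  rw [abs_le] at hy
  nlinarith

theorem vec_eq_small {n : ℕ} {x y x' y' : ℤ} (h : D.vec n (x * D.L n, y) = D.vec n (x' * D.L n, y'))
    (hy : |y' - y| ≤ 10) (hx : |x' - x| < 4) : x = x' ∧ y = y' := by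
  obtain ⟨h1, h2⟩ := D.vec_eq_iff.1 h
  have hl := D.large n
  have hn : (0 : ℤ) ≤ n := by positivity
  have hL : (100 : ℤ) ≤ D.L n := by
    nlinarith [mul_nonneg hn hn, mul_nonneg hn (mul_nonneg hn hn)]
  have e2 := D.small_of_dvd h2 (by simp only; omega)
  have e1 := D.small_of_dvd h1 (by
    simp only
    rw [← sub_mul, abs_mul, abs_of_nonneg (by omega : (0 : ℤ) ≤ D.L n)]
    nlinarith)
  simp only at e1 e2
  rw [← sub_mul] at e1
  rcases mul_eq_zero.1 e1 with e1 | e1 <;> constructor <;> omega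

theorem dev_ne_out (n : ℕ) : D.dev κ n ≠ D.out n := D.vec_ne_out _ _ _ (by simp)

theorem dev'_ne_out (n : ℕ) : D.dev' κ n ≠ D.out n := by
  have := D.vec_ne_out n (mult κ n * D.L n) 1 (by simp)
  simpa [dev', devZ] using this

theorem zero_ne_out (n : ℕ) : 0 ≠ D.out n := by
  have := D.vec_ne_out n 0 0 (by simp)
  rwa [← Prod.zero_eq_mk, vec_zero] at this

theorem dev_ne_dev' (n : ℕ) : D.dev κ n ≠ D.dev' κ n := by
  intro h
  have := D.vec_eq_small (n := n) (x := mult κ n) (y := 0) (x' := mult κ n) (y' := 1)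
    (by simpa [dev, dev', devZ] using h) (by simp) (by simp)
  simp at this

theorem zero_ne_dev (n : ℕ) : 0 ≠ D.dev κ n := by
  intro h
  have := D.vec_eq_small (n := n) (x := 0) (y := 0) (x' := mult κ n) (y' := 0)
    (by rw [zero_mul, ← Prod.zero_eq_mk, vec_zero, h]; rfl) (by simp)
    (by rcases mult_cases κ n with h | h <;> rw [h] <;> simp)
  rcases mult_cases κ n with h | h <;> rw [h] at this <;> simp at this

theorem zero_ne_dev' (n : ℕ) : 0 ≠ D.dev' κ n := by
  intro h
  have := D.vec_eq_small (n := n) (x := 0) (y := 0) (x' := mult κ n) (y' := 1)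
    (by rw [zero_mul, ← Prod.zero_eq_mk, vec_zero, h]; simp [dev', devZ]) (by simp)
    (by rcases mult_cases κ n with h | h <;> rw [h] <;> simp)
  simp at this

theorem tau_left_inv : Function.LeftInverse (D.tauInv κ) (D.tauFun κ) := by
  have h1 := D.dev_ne_out κ
  have h2 := D.dev'_ne_out κ
  have h3 := D.zero_ne_out
  have h4 := D.dev_ne_dev' κ
  have h5 := D.zero_ne_dev κ
  have h6 := D.zero_ne_dev' κ
  rintro (⟨n, q⟩ | ⟨n, s⟩ | n)
  · simp only [tauFun]
    split_ifs with c1 c2 c3 c4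
    · simp [tauInv, c1]
    · simp [tauInv, c2, h2, (h4 n).symm]
    · simp [tauInv, c3, h1]
    · cases n <;> simp [prevOut, tauInv, c4, h3, h5, h6, prevEnd]
    · simp [tauInv, c1, c2, c3, c4]
  · simp only [tauFun]
    split_ifs with c1
    · simp [tauInv, c1]
    · simp [tauInv, c1]
  · simp [tauFun, tauInv, prevEnd, h3, h5, h6]

theorem tau_right_inv : Function.RightInverse (D.tauInv κ) (D.tauFun κ) := by
  have h1 := D.dev_ne_out κ
  have h2 := D.dev'_ne_out κ
  have h3 := D.zero_ne_out
  have h4 := D.dev_ne_dev' κ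
  have h5 := D.zero_ne_dev κ
  have h6 := D.zero_ne_dev' κ
  rintro (⟨n, q⟩ | ⟨n, s⟩ | n)
  · simp only [tauInv]
    split_ifs with c1 c2 c3 c4
    · simp [tauFun, c1, h3, h5, h6, prevOut]
    · simp [tauFun, c2, h2, (h4 n).symm]
    · simp [tauFun, c3, h1]
    · cases n <;> simp [prevOut, tauFun, c4, h3, h5, h6, prevEnd]
    · simp [tauFun, c1, c2, c3, c4]
  · simp only [tauInv]
    split_ifs with c1
    · simp [tauFun, c1]
    · simp [tauFun, c1]
  · simp [tauFun, tauInv]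

/-- The gluing permutation. -/
noncomputable def tau : Equiv.Perm D.Pt :=
  ⟨D.tauFun κ, D.tauInv κ, D.tau_left_inv κ, D.tau_right_inv κ⟩

open Classical in
/-- The displacement of a generator on the tori. -/
noncomputable def disp (i : ι) : ℤ × ℤ :=
  if i = D.a then (1, 0) else if i = D.b then (0, 1) else 0

/-- The action of a generator on the disjoint union of the pieces, before gluing. -/
noncomputable def sig (i : ι) : Equiv.Perm D.Pt where
  toFun
    | T n q => T n (q + D.vec n (D.disp i))
    | Q n s => Q n (D.σ i n s)
    | e n => e n
  invFun
    | T n q => T n (q - D.vec n (D.disp i))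
    | Q n s => Q n ((D.σ i n)⁻¹ s)
    | e n => e n
  left_inv := by rintro (⟨n, q⟩ | ⟨n, s⟩ | n) <;> simp
  right_inv := by rintro (⟨n, q⟩ | ⟨n, s⟩ | n) <;> simp

open Classical in
/-- The action of a generator. -/
noncomputable def gen (i : ι) : Equiv.Perm D.Pt :=
  if i = D.b then D.sig i * D.tau κ else D.sig i

/-- The action of the free group. -/
noncomputable def act : FreeGroup ι →* Equiv.Perm D.Pt := FreeGroup.lift (D.gen κ)

@[simp] theorem sig_T (i : ι) (n : ℕ) (q : D.Torus n) :
    D.sig i (T n q) = T n (q + D.vec n (D.disp i)) := rfl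

@[simp] theorem sig_Q (i : ι) (n : ℕ) (s) : D.sig i (Q n s) = Q n (D.σ i n s) := rfl

@[simp] theorem sig_e (i : ι) (n : ℕ) : D.sig i (e n) = e n := rfl

@[simp] theorem sig_inv_T (i : ι) (n : ℕ) (q : D.Torus n) :
    (D.sig i)⁻¹ (T n q) = T n (q - D.vec n (D.disp i)) := rfl

@[simp] theorem lev_sig (i : ι) (x : D.Pt) : (D.sig i x).lev = x.lev := by
  rcases x with ⟨n, q⟩ | ⟨n, s⟩ | n <;> rfl

@[simp] theorem lev_sig_inv (i : ι) (x : D.Pt) : ((D.sig i)⁻¹ x).lev = x.lev := by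
  rcases x with ⟨n, q⟩ | ⟨n, s⟩ | n <;> rfl

@[simp] theorem disp_a : D.disp D.a = (1, 0) := by simp [disp]

@[simp] theorem disp_b : D.disp D.b = (0, 1) := by simp [disp, D.a_ne_b.symm]

theorem gen_b : D.gen κ D.b = D.sig D.b * D.tau κ := by simp [gen]

theorem gen_of_ne {i : ι} (h : i ≠ D.b) : D.gen κ i = D.sig i := by simp [gen, h]

@[simp] theorem act_of (i : ι) : D.act κ (FreeGroup.of i) = D.gen κ i := by simp [act]

theorem tau_T_of_not_mem {n : ℕ} {q : D.Torus n} (h : q ≠ D.out n)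
    (h' : q ∉ D.vec n '' D.baseZ κ n) : D.tau κ (T n q) = T n q := by
  have h1 : q ≠ D.dev κ n := fun h => h' ⟨_, by simp [baseZ], h.symm⟩
  have h2 : q ≠ D.dev' κ n := fun h => h' ⟨_, by simp [baseZ], h.symm⟩
  have h3 : q ≠ 0 := fun h => h' ⟨0, by simp [baseZ], by simp [h, vec_zero]⟩
  simp [tau, tauFun, h, h1, h2, h3]

theorem tau_inv_T_of_not_mem {n : ℕ} {q : D.Torus n} (h : q ≠ D.out n)
    (h' : q ∉ D.vec n '' D.baseZ κ n) : (D.tau κ)⁻¹ (T n q) = T n q := by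
  rw [Equiv.Perm.inv_eq_iff_eq, tau_T_of_not_mem D κ h h']

@[simp] theorem tau_out (n : ℕ) : D.tau κ (T n (D.out n)) = Q n (D.z n) := by
  simp [tau, tauFun]

@[simp] theorem tau_dev (n : ℕ) : D.tau κ (T n (D.dev κ n)) = T n (D.dev' κ n) := by
  simp [tau, tauFun, D.dev_ne_out κ n]

@[simp] theorem tau_dev' (n : ℕ) : D.tau κ (T n (D.dev' κ n)) = T n (D.dev κ n) := by
  simp [tau, tauFun, D.dev'_ne_out κ n, (D.dev_ne_dev' κ n).symm]

@[simp] theorem tau_zero (n : ℕ) : D.tau κ (T n 0) = D.prevOut n := by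
  simp [tau, tauFun, D.zero_ne_out n, D.zero_ne_dev κ n, D.zero_ne_dev' κ n]

@[simp] theorem tau_z (n : ℕ) : D.tau κ (Q n (D.z n)) = e n := by
  simp [tau, tauFun]

theorem tau_Q (n : ℕ) {s} (h : s ≠ D.z n) : D.tau κ (Q n s) = Q n s := by
  simp [tau, tauFun, h]

@[simp] theorem tau_e (n : ℕ) : D.tau κ (e n) = T (n + 1) 0 := rfl

/-- The gluing permutation on a torus. -/
theorem tau_T_cases {n : ℕ} {q : D.Torus n} (h : q ≠ D.out n) :
    D.tau κ (T n q) = T n q ∨ (D.tau κ (T n q)).lev < n ∨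
      ∃ s ∈ D.baseZ κ n, D.tau κ (T n q) = T n (D.vec n s) := by
  by_cases h' : q ∈ D.vec n '' D.baseZ κ n
  · right
    obtain ⟨s, rfl | rfl | rfl, rfl⟩ := h'
    · rw [vec_zero, tau_zero]
      cases n with
      | zero => exact Or.inr ⟨0, by simp [baseZ], by simp [prevOut, vec_zero]⟩
      | succ n => exact Or.inl (Nat.lt_succ_self n)
    · exact Or.inr ⟨_, by simp [baseZ], D.tau_dev κ n⟩
    · exact Or.inr ⟨_, by simp [baseZ], D.tau_dev' κ n⟩
  · exact Or.inl (D.tau_T_of_not_mem κ h h')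

theorem tau_inv_T_cases {n : ℕ} {q : D.Torus n} (h : q ≠ D.out n) :
    (D.tau κ)⁻¹ (T n q) = T n q ∨ ((D.tau κ)⁻¹ (T n q)).lev < n ∨
      ∃ s ∈ D.baseZ κ n, (D.tau κ)⁻¹ (T n q) = T n (D.vec n s) := by
  by_cases h' : q ∈ D.vec n '' D.baseZ κ n
  · right
    obtain ⟨s, rfl | rfl | rfl, rfl⟩ := h'
    · rw [vec_zero]
      cases n with
      | zero =>
        refine Or.inr ⟨0, by simp [baseZ], ?_⟩
        rw [Equiv.Perm.inv_eq_iff_eq, vec_zero, tau_zero]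
        rfl
      | succ n =>
        refine Or.inl ?_
        have : (D.tau κ)⁻¹ (T (n + 1) 0) = e n := by rw [Equiv.Perm.inv_eq_iff_eq, tau_e]
        rw [this]
        exact Nat.lt_succ_self n
    · refine Or.inr ⟨_, by simp [baseZ], Equiv.Perm.inv_eq_iff_eq.2 (D.tau_dev' κ n).symm⟩
    · refine Or.inr ⟨_, by simp [baseZ], Equiv.Perm.inv_eq_iff_eq.2 (D.tau_dev κ n).symm⟩
  · exact Or.inl (D.tau_inv_T_of_not_mem κ h h')

/-- The gluing permutation only leaves an initial part through the last connecting point. -/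
theorem tau_lev {n : ℕ} {x : D.Pt} (h : x.lev ≤ n) (hx : x ≠ e n) :
    (D.tau κ x).lev ≤ n := by
  rcases x with ⟨m, q⟩ | ⟨m, s⟩ | m
  · by_cases hq : q = D.out m
    · subst hq
      rw [tau_out]
      exact h
    · rcases D.tau_T_cases κ hq with h1 | h1 | ⟨s, -, h1⟩
      · rwa [h1]
      · exact h1.le.trans h
      · rwa [h1]
  · by_cases hs : s = D.z m
    · subst hs
      rw [tau_z]
      exact h
    · rwa [tau_Q D κ m hs]
  · have : m ≠ n := fun h => hx (by rw [h])
    simp only [Pt.lev, tau_e] at h ⊢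
    omega

theorem tau_inv_lev {n : ℕ} {x : D.Pt} (h : x.lev ≤ n) (hx : x ≠ T n (D.out n)) :
    ((D.tau κ)⁻¹ x).lev ≤ n := by
  rcases x with ⟨m, q⟩ | ⟨m, s⟩ | m
  · by_cases hq : q = D.out m
    · subst hq
      have : m ≠ n := fun h => hx (by rw [h])
      have h1 : (D.tau κ)⁻¹ (T m (D.out m)) = T (m + 1) 0 := by
        rw [Equiv.Perm.inv_eq_iff_eq, tau_zero]
        rfl
      rw [h1]
      simp only [Pt.lev] at h ⊢
      omega
    · rcases D.tau_inv_T_cases κ hq with h1 | h1 | ⟨s, -, h1⟩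
      · rwa [h1]
      · exact h1.le.trans h
      · rwa [h1]
  · by_cases hs : s = D.z m
    · subst hs
      have h1 : (D.tau κ)⁻¹ (Q m (D.z m)) = T m (D.out m) := by
        rw [Equiv.Perm.inv_eq_iff_eq, tau_out]
      rwa [h1]
    · have h1 : (D.tau κ)⁻¹ (Q m s) = Q m s := by
        rw [Equiv.Perm.inv_eq_iff_eq, tau_Q D κ m hs]
      rwa [h1]
  · have h1 : (D.tau κ)⁻¹ (e m) = Q m (D.z m) := by
      rw [Equiv.Perm.inv_eq_iff_eq, tau_z]
    rwa [h1]

/-- Lines of small slope through the non-translation points of a torus miss a neighbourhood of the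
outgoing point. -/
theorem vec_line_ne_out {n : ℕ} {s v r : ℤ × ℤ} (hs : s ∈ D.baseZ κ n) (j : ℤ)
    (hv1 : |v.1| ≤ n) (hv2 : |v.2| ≤ n) (hr1 : |r.1| ≤ 2 * n + 1) (hr2 : |r.2| ≤ 2 * n + 1) :
    D.vec n (s + j • v + r) ≠ D.out n := by
  intro h
  obtain ⟨h1, h2⟩ := D.vec_eq_iff.1 h
  obtain ⟨c, hc, s2, hs0, hs1, rfl⟩ :
      ∃ c : ℤ, (0 ≤ c ∧ c ≤ 3) ∧ ∃ s2 : ℤ, 0 ≤ s2 ∧ s2 ≤ 1 ∧ s = (c * D.L n, s2) := by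
    have := mult_cases κ n
    rcases hs with rfl | rfl | rfl
    · exact ⟨0, by simp, 0, by simp, by simp, by rw [zero_mul]; rfl⟩
    · exact ⟨mult κ n, by omega, 0, by simp, by simp, by simp [devZ]⟩
    · exact ⟨mult κ n, by omega, 1, by simp, by simp, by simp [devZ]⟩
  obtain ⟨v1, v2⟩ := v
  obtain ⟨r1, r2⟩ := r
  simp only [outZ, Prod.fst_add, Prod.snd_add, Prod.smul_fst, Prod.smul_snd, smul_eq_mul] at *
  have hl := D.large n
  obtain ⟨N, hN⟩ : ∃ N : ℤ, N = n + 1 := ⟨_, rfl⟩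
  have hN1 : 1 ≤ N := by omega
  rw [← hN] at h1 h2 hl
  set W : ℤ := 4 * D.L n with hW
  have hM : 400 * N ^ 3 ≤ W := by omega
  rw [abs_le] at hv1 hv2 hr1 hr2
  have hNN : N ≤ N ^ 2 := by nlinarith
  have hNNN : N ^ 2 ≤ N ^ 3 := by nlinarith [mul_nonneg (sq_nonneg N) (by omega : 0 ≤ N - 1)]
  have hp1 : 2 * N ≤ 4 * N - r1 := by omega
  have hp2 : 4 * N - r1 ≤ 6 * N := by omega
  have hq1 : 14 * N ^ 2 ≤ (4 * N) ^ 2 - (r2 + s2) := by nlinarith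
  have hq2 : (4 * N) ^ 2 - (r2 + s2) ≤ 18 * N ^ 2 := by nlinarith
  set p := 4 * N - r1 with hp
  set q := (4 * N) ^ 2 - (r2 + s2) with hq
  have hd : W ∣ 4 * (v2 * p - v1 * q) := by
    have : 4 * (v2 * p - v1 * q) = 4 * v2 * (4 * N - (c * D.L n + j * v1 + r1))
        - 4 * v1 * ((4 * N) ^ 2 - (s2 + j * v2 + r2)) + W * (v2 * c) := by
      rw [hp, hq, hW]; ring
    rw [this]
    exact dvd_add (dvd_sub (Dvd.dvd.mul_left h1 _) (Dvd.dvd.mul_left h2 _)) (dvd_mul_right _ _)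
  have hb1 : |v2 * p| ≤ N * (6 * N) := by
    rw [abs_mul]
    exact mul_le_mul (abs_le.2 ⟨by omega, by omega⟩) (abs_le.2 ⟨by omega, by omega⟩)
      (abs_nonneg _) (by omega)
  have hb2 : |v1 * q| ≤ N * (18 * N ^ 2) := by
    rw [abs_mul]
    exact mul_le_mul (abs_le.2 ⟨by omega, by omega⟩) (abs_le.2 ⟨by nlinarith, by omega⟩)
      (abs_nonneg _) (by omega)
  have hz : 4 * (v2 * p - v1 * q) = 0 := by
    refine Int.eq_zero_of_abs_lt_dvd hd ?_
    rw [abs_le] at hb1 hb2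
    rw [abs_lt]
    constructor <;> nlinarith
  have hz' : v2 * p = v1 * q := by omega
  have hv1' : v1 = 0 := by
    by_contra h0
    have h3 : 14 * N ^ 2 ≤ |v1 * q| := by
      rw [abs_mul, abs_of_nonneg (by nlinarith : 0 ≤ q)]
      have : 1 ≤ |v1| := Int.one_le_abs h0
      nlinarith
    rw [← hz'] at h3
    nlinarith
  have hv2' : v2 = 0 := by
    rw [hv1', zero_mul] at hz'
    rcases mul_eq_zero.1 hz' with h | h
    · exact h
    · omega
  subst hv1' hv2'
  have hd' : W ∣ 4 * p := by
    have : 4 * p = 4 * (4 * N - (c * D.L n + j * 0 + r1)) + W * c := by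
      rw [hp, hW]; ring
    rw [this]
    exact dvd_add (Dvd.dvd.mul_left h1 _) (dvd_mul_right _ _)
  have := Int.eq_zero_of_abs_lt_dvd hd' (by
    rw [abs_lt]
    constructor <;> nlinarith)
  omega

/-- The region swept by powers of a short word that start in an initial part. -/
def Swept (n : ℕ) (v d : ℤ × ℤ) (x : D.Pt) : Prop :=
  x.lev < n ∨ ∃ s ∈ D.baseZ κ n, ∃ j : ℤ, ∃ u : ℤ × ℤ, |u.1| ≤ n ∧ |u.2| ≤ n ∧
    x = T n (D.vec n (s + j • v + (d + u)))

variable {D κ}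

theorem swept_sig {n : ℕ} {v d : ℤ × ℤ} {x : D.Pt} (h : D.Swept κ n v d x) (i : ι) :
    D.Swept κ n v (d + D.disp i) (D.sig i x) := by
  rcases h with h | ⟨s, hs, j, u, hu1, hu2, rfl⟩
  · exact Or.inl (by simpa using h)
  · refine Or.inr ⟨s, hs, j, u, hu1, hu2, ?_⟩
    rw [sig_T, ← vec_add]
    congr 2
    abel

theorem swept_sig_inv {n : ℕ} {v d : ℤ × ℤ} {x : D.Pt} (h : D.Swept κ n v d x) (i : ι) :
    D.Swept κ n v (d - D.disp i) ((D.sig i)⁻¹ x) := by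
  rcases h with h | ⟨s, hs, j, u, hu1, hu2, rfl⟩
  · exact Or.inl (by rw [lev_sig_inv]; exact h)
  · refine Or.inr ⟨s, hs, j, u, hu1, hu2, ?_⟩
    rw [sig_inv_T, ← vec_sub]
    congr 2
    abel

theorem swept_base {n : ℕ} {v d s : ℤ × ℤ} (hs : s ∈ D.baseZ κ n)
    (hd1 : |d.1| ≤ n) (hd2 : |d.2| ≤ n) : D.Swept κ n v d (T n (D.vec n s)) :=
  Or.inr ⟨s, hs, 0, -d, by simpa using hd1, by simpa using hd2, by simp⟩

theorem abs_add_le_of {n : ℕ} {x y : ℤ} (hx : |x| ≤ n) (hy : |y| ≤ n) :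
    |x + y| ≤ 2 * n + 1 := by
  have := abs_add_le x y
  omega

theorem swept_tau {n : ℕ} {v d : ℤ × ℤ} {x : D.Pt} (h : D.Swept κ n v d x)
    (hv1 : |v.1| ≤ n) (hv2 : |v.2| ≤ n) (hd1 : |d.1| ≤ n) (hd2 : |d.2| ≤ n) :
    D.Swept κ n v d (D.tau κ x) := by
  have h0 : (0 : ℤ × ℤ) ∈ D.baseZ κ n := by simp [baseZ]
  rcases h with h | ⟨s, hs, j, u, hu1, hu2, rfl⟩
  · obtain ⟨m, rfl⟩ : ∃ m, n = m + 1 := ⟨n - 1, by omega⟩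
    by_cases hx : x = e m
    · subst hx
      rw [tau_e, ← vec_zero]
      exact swept_base h0 hd1 hd2
    · exact Or.inl (Nat.lt_succ_of_le (D.tau_lev κ (Nat.le_of_lt_succ h) hx))
  · have hne := D.vec_line_ne_out κ hs j hv1 hv2 (r := d + u) (abs_add_le_of hd1 hu1)
      (abs_add_le_of hd2 hu2)
    rcases D.tau_T_cases κ hne with h1 | h1 | ⟨s', hs', h1⟩
    · rw [h1]
      exact Or.inr ⟨s, hs, j, u, hu1, hu2, rfl⟩
    · exact Or.inl h1
    · rw [h1]
      exact swept_base hs' hd1 hd2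

theorem swept_tau_inv {n : ℕ} {v d : ℤ × ℤ} {x : D.Pt} (h : D.Swept κ n v d x)
    (hv1 : |v.1| ≤ n) (hv2 : |v.2| ≤ n) (hd1 : |d.1| ≤ n) (hd2 : |d.2| ≤ n) :
    D.Swept κ n v d ((D.tau κ)⁻¹ x) := by
  have h0 : (0 : ℤ × ℤ) ∈ D.baseZ κ n := by simp [baseZ]
  rcases h with h | ⟨s, hs, j, u, hu1, hu2, rfl⟩
  · obtain ⟨m, rfl⟩ : ∃ m, n = m + 1 := ⟨n - 1, by omega⟩
    by_cases hx : x = T m (D.out m)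
    · have h1 : (D.tau κ)⁻¹ x = T (m + 1) (D.vec (m + 1) 0) := by
        rw [Equiv.Perm.inv_eq_iff_eq, vec_zero, tau_zero, hx]
        rfl
      rw [h1]
      exact swept_base h0 hd1 hd2
    · exact Or.inl (Nat.lt_succ_of_le (D.tau_inv_lev κ (Nat.le_of_lt_succ h) hx))
  · have hne := D.vec_line_ne_out κ hs j hv1 hv2 (r := d + u) (abs_add_le_of hd1 hu1)
      (abs_add_le_of hd2 hu2)
    rcases D.tau_inv_T_cases κ hne with h1 | h1 | ⟨s', hs', h1⟩
    · rw [h1]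
      exact Or.inr ⟨s, hs, j, u, hu1, hu2, rfl⟩
    · exact Or.inl h1
    · rw [h1]
      exact swept_base hs' hd1 hd2

variable (D κ)

/-- The total displacement of a word. -/
noncomputable def wdisp : List (ι × Bool) → ℤ × ℤ
  | [] => 0
  | (i, true) :: l => wdisp l + D.disp i
  | (i, false) :: l => wdisp l - D.disp i

theorem abs_disp_le (i : ι) : |(D.disp i).1| ≤ 1 ∧ |(D.disp i).2| ≤ 1 := by
  unfold disp
  split_ifs <;> simp

theorem abs_wdisp_le (l : List (ι × Bool)) :
    |(D.wdisp l).1| ≤ l.length ∧ |(D.wdisp l).2| ≤ l.length := by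
  induction l with
  | nil => simp [wdisp]
  | cons x l ih =>
    obtain ⟨i, _ | _⟩ := x
    all_goals
      have := D.abs_disp_le i
      simp only [wdisp, Prod.fst_sub, Prod.snd_sub, Prod.fst_add, Prod.snd_add, List.length_cons,
        Nat.cast_add, Nat.cast_one, abs_le] at *
      omega

theorem mk_cons (i : ι) (ε : Bool) (l : List (ι × Bool)) :
    FreeGroup.mk ((i, ε) :: l) = (cond ε (FreeGroup.of i) (FreeGroup.of i)⁻¹) * FreeGroup.mk l := by
  cases ε <;> rfl

theorem swept_word {n : ℕ} {v : ℤ × ℤ} (hv1 : |v.1| ≤ n) (hv2 : |v.2| ≤ n) {x : D.Pt}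
    (hx : D.Swept κ n v 0 x) (l : List (ι × Bool)) (hl : l.length ≤ n) :
    D.Swept κ n v (D.wdisp l) (D.act κ (FreeGroup.mk l) x) := by
  induction l with
  | nil => simpa [wdisp, ← FreeGroup.one_eq_mk] using hx
  | cons y l ih =>
    have hl' : l.length ≤ n := by simp at hl; omega
    have ih := ih hl'
    obtain ⟨hd1, hd2⟩ := D.abs_wdisp_le l
    have hd1' : |(D.wdisp l).1| ≤ n := hd1.trans (by exact_mod_cast hl')
    have hd2' : |(D.wdisp l).2| ≤ n := hd2.trans (by exact_mod_cast hl')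
    obtain ⟨hc1, hc2⟩ := D.abs_wdisp_le (y :: l)
    have hc1' : |(D.wdisp (y :: l)).1| ≤ n := hc1.trans (by exact_mod_cast hl)
    have hc2' : |(D.wdisp (y :: l)).2| ≤ n := hc2.trans (by exact_mod_cast hl)
    obtain ⟨i, _ | _⟩ := y
    · rw [mk_cons]
      simp only [cond_false, map_mul, map_inv, act_of, Equiv.Perm.mul_apply]
      by_cases hi : i = D.b
      · subst hi
        rw [gen_b, mul_inv_rev, Equiv.Perm.mul_apply]
        exact swept_tau_inv (swept_sig_inv ih _) hv1 hv2 hc1' hc2'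
      · rw [gen_of_ne D κ hi]
        exact swept_sig_inv ih _
    · rw [mk_cons]
      simp only [cond_true, map_mul, act_of, Equiv.Perm.mul_apply]
      by_cases hi : i = D.b
      · subst hi
        rw [gen_b, Equiv.Perm.mul_apply]
        exact swept_sig (swept_tau ih hv1 hv2 hd1' hd2') _
      · rw [gen_of_ne D κ hi]
        exact swept_sig ih _

theorem finite_lev_le (n : ℕ) : {x : D.Pt | x.lev ≤ n}.Finite := by
  have : {x : D.Pt | x.lev ≤ n} ⊆ ⋃ m ∈ Set.Iic n,
      (Set.range (T m) ∪ Set.range (Q m) ∪ {e m}) := by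
    rintro (⟨m, q⟩ | ⟨m, s⟩ | m) h <;> simp_all [Pt.lev]
  refine Set.Finite.subset ((Set.finite_Iic n).biUnion fun m _ => ?_) this
  exact ((Set.finite_range _).union (Set.finite_range _)).union (Set.finite_singleton _)

/-- Every element of the free group acts with finite orbits. -/
theorem exists_pow_act_eq (g : FreeGroup ι) (x : D.Pt) : ∃ n : ℕ, 1 ≤ n ∧ D.act κ (g ^ n) x = x := by
  obtain ⟨l, rfl⟩ := Quot.exists_rep g
  obtain ⟨N, hN1, hN2⟩ : ∃ N, l.length ≤ N ∧ x.lev < N :=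
    ⟨max l.length (x.lev + 1), le_max_left _ _, lt_of_lt_of_le (Nat.lt_succ_self _) (le_max_right _ _)⟩
  obtain ⟨hd1, hd2⟩ := D.abs_wdisp_le l
  have hd1' : |(D.wdisp l).1| ≤ N := hd1.trans (by exact_mod_cast hN1)
  have hd2' : |(D.wdisp l).2| ≤ N := hd2.trans (by exact_mod_cast hN1)
  change ∃ n : ℕ, 1 ≤ n ∧ D.act κ (FreeGroup.mk l ^ n) x = x
  set f := D.act κ (FreeGroup.mk l) with hf
  have hinv : ∀ k : ℕ, D.Swept κ N (D.wdisp l) 0 ((f ^ k) x) := by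
    intro k
    induction k with
    | zero => exact Or.inl (by simpa using hN2)
    | succ k ih =>
      rw [pow_succ', Equiv.Perm.mul_apply]
      rcases D.swept_word κ hd1' hd2' ih l hN1 with h | ⟨s, hs, j, u, hu1, hu2, h⟩
      · exact Or.inl h
      · refine Or.inr ⟨s, hs, j + 1, u, hu1, hu2, ?_⟩
        rw [h, add_smul, one_smul]
        congr 2
        abel
  have hlev : ∀ k : ℕ, (f ^ k) x ∈ {y : D.Pt | y.lev ≤ N} := by
    intro k
    rcases hinv k with h | ⟨s, hs, j, u, hu1, hu2, h⟩
    · exact h.le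
    · rw [h]; exact le_refl N
  obtain ⟨i, j, hij, h⟩ : ∃ i j : ℕ, i < j ∧ (f ^ i) x = (f ^ j) x :=
    (D.finite_lev_le N).exists_lt_map_eq_of_forall_mem hlev
  refine ⟨j - i, by omega, ?_⟩
  rw [map_pow, ← hf]
  apply (f ^ i).injective
  rw [← Equiv.Perm.mul_apply, ← pow_add, h]
  congr 2
  omega

theorem sig_zpow_T (i : ι) (k : ℤ) (n : ℕ) (q : D.Torus n) :
    (D.sig i ^ k) (T n q) = T n (q + D.vec n (k • D.disp i)) := by
  induction k with
  | zero => simp [vec_zero]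
  | succ k ih =>
    rw [add_comm, zpow_one_add, Equiv.Perm.mul_apply, ih, sig_T, add_assoc, ← vec_add, add_smul,
      one_smul, add_comm (D.disp i)]
  | pred k ih =>
    rw [sub_eq_add_neg, add_comm, zpow_add, zpow_neg_one, Equiv.Perm.mul_apply, ih, sig_inv_T,
      add_sub_assoc, ← vec_sub, add_smul _ _ (D.disp i), neg_one_smul, neg_add_eq_sub]

theorem gen_a : D.gen κ D.a = D.sig D.a := D.gen_of_ne κ D.a_ne_b

theorem act_a_zpow_T (k : ℤ) (n : ℕ) (q : D.Torus n) :
    D.act κ (FreeGroup.of D.a ^ k) (T n q) = T n (q + D.vec n (k, 0)) := by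
  rw [map_zpow, act_of, gen_a, sig_zpow_T]
  simp

theorem act_b (x : D.Pt) : D.act κ (FreeGroup.of D.b) x = D.sig D.b (D.tau κ x) := by
  rw [act_of, gen_b, Equiv.Perm.mul_apply]

/-- The gluing permutation is trivial on the second column of each torus. -/
theorem tau_column (n : ℕ) (j : ℤ) : D.tau κ (T n (D.vec n (1, j))) = T n (D.vec n (1, j)) := by
  have hl := D.large n
  have hn : (0 : ℤ) ≤ n := by positivity
  have hL : 100 * ((n : ℤ) + 1) ≤ D.L n := by
    nlinarith [mul_nonneg hn hn, mul_nonneg hn (mul_nonneg hn hn)]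
  refine D.tau_T_of_not_mem κ (fun h => ?_) ?_
  · have h1 := D.small_of_dvd (D.vec_eq_iff.1 h).1 (by
      simp only [outZ]; rw [abs_lt]; constructor <;> linarith)
    simp only [outZ] at h1
    omega
  · rintro ⟨s, hs, h⟩
    have hs' : s.1 = 0 ∨ s.1 = 2 * D.L n ∨ s.1 = 3 * D.L n := by
      have := mult_cases κ n
      rcases hs with rfl | rfl | rfl
      · exact Or.inl rfl
      · rcases this with h | h <;> simp [devZ, h]
      · rcases this with h | h <;> simp [devZ, h]
    have h1 := D.small_of_dvd (D.vec_eq_iff.1 h).1 (by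
      simp only; rw [abs_lt]; rcases hs' with h | h | h <;> rw [h] <;> constructor <;> linarith)
    simp only at h1
    rcases hs' with h | h | h <;> rw [h] at h1 <;> omega

theorem act_of_Q {n : ℕ} {i : ι} {s s' : suffixSet (D.w n)}
    (h : FreeGroup.of i * (s : FreeGroup ι) = s') :
    D.act κ (FreeGroup.of i) (Q n s) = Q n s' := by
  have h' : FreeGroup.of i * (s : FreeGroup ι) ∈ suffixSet (D.w n) := h ▸ s'.2
  have hσ : D.σ i n s = s' := by rw [D.σ_apply i n s h']; exact Subtype.ext h
  by_cases hi : i = D.b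
  · subst hi
    have hs : s ≠ D.z n := fun hs => D.z_last n (hs ▸ h')
    rw [act_b, tau_Q D κ n hs, sig_Q, hσ]
  · rw [act_of, gen_of_ne D κ hi, sig_Q, hσ]

theorem act_mk_Q_one {n : ℕ} (l : List (ι × Bool)) (hl : l <:+ D.w n) :
    D.act κ (FreeGroup.mk l) (Q n ⟨1, one_mem_suffixSet _⟩) = Q n ⟨FreeGroup.mk l, l, hl, rfl⟩ := by
  induction l with
  | nil => simp [← FreeGroup.one_eq_mk]
  | cons y l ih =>
    have hl' : l <:+ D.w n := (List.suffix_cons y l).trans hl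
    obtain ⟨i, _ | _⟩ := y
    · simp only [mk_cons, cond_false, map_mul, map_inv, Equiv.Perm.mul_apply, ih hl']
      rw [Equiv.Perm.inv_eq_iff_eq, act_of_Q]
      simp
    · simp only [mk_cons, cond_true, map_mul, Equiv.Perm.mul_apply, ih hl']
      rw [act_of_Q]
      rfl

theorem act_injective : Function.Injective (D.act κ) := by
  rw [injective_iff_map_eq_one]
  intro g hg
  obtain ⟨l, rfl⟩ := Quot.exists_rep g
  change D.act κ (FreeGroup.mk l) = 1 at hg
  obtain ⟨n, rfl⟩ := D.w_surj l
  have := D.act_mk_Q_one κ (D.w n) List.suffix_rfl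
  rw [hg, Equiv.Perm.one_apply, Pt.Q.injEq] at this
  have h2 := congrArg Subtype.val (eq_of_heq this.2)
  exact h2.symm

/-- Two points are joined by a group element that does not depend on the parameter. -/
def Reach (x y : D.Pt) : Prop := ∃ f : FreeGroup ι, ∀ κ, D.act κ f x = y

variable {D}

theorem Reach.symm {x y : D.Pt} (h : D.Reach x y) : D.Reach y x := by
  obtain ⟨f, hf⟩ := h
  exact ⟨f⁻¹, fun κ => by rw [map_inv, Equiv.Perm.inv_eq_iff_eq, hf]⟩

theorem Reach.trans {x y z : D.Pt} (h : D.Reach x y) (h' : D.Reach y z) : D.Reach x z := by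
  obtain ⟨f, hf⟩ := h
  obtain ⟨f', hf'⟩ := h'
  exact ⟨f' * f, fun κ => by rw [map_mul, Equiv.Perm.mul_apply, hf, hf']⟩

variable (D)

theorem reach_row (n : ℕ) (x x' y : ℤ) : D.Reach (T n (D.vec n (x, y))) (T n (D.vec n (x', y))) :=
  ⟨FreeGroup.of D.a ^ (x' - x), fun κ => by rw [act_a_zpow_T, ← vec_add]; simp⟩

theorem reach_column (n : ℕ) (y : ℤ) : D.Reach (T n (D.vec n (1, 0))) (T n (D.vec n (1, y))) := by
  have step (y : ℤ) : D.Reach (T n (D.vec n (1, y))) (T n (D.vec n (1, y + 1))) :=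
    ⟨FreeGroup.of D.b, fun κ => by rw [act_b, tau_column, sig_T, disp_b, ← vec_add]; simp⟩
  induction y with
  | zero => exact ⟨1, by simp⟩
  | succ k ih => exact ih.trans (step _)
  | pred k ih => exact ih.trans (by simpa using (step (-k - 1)).symm)

theorem reach_torus (n : ℕ) (q q' : D.Torus n) : D.Reach (T n q) (T n q') := by
  have key (q : D.Torus n) : D.Reach (T n (D.vec n (1, 0))) (T n q) := by
    obtain ⟨⟨x, y⟩, rfl⟩ := D.exists_vec n q
    exact (D.reach_column n y).trans (D.reach_row n 1 x y)
  exact (key q).symm.trans (key q')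

theorem reach_Q_one (n : ℕ) (s : suffixSet (D.w n)) :
    D.Reach (Q n ⟨1, one_mem_suffixSet _⟩) (Q n s) := by
  obtain ⟨_, l, hl, rfl⟩ := s
  exact ⟨_, fun κ => D.act_mk_Q_one κ l hl⟩

theorem reach_Q (n : ℕ) (q : D.Torus n) (s : suffixSet (D.w n)) : D.Reach (T n q) (Q n s) :=
  ((D.reach_torus n q (D.out n)).trans
    ⟨FreeGroup.of D.b, fun κ => by rw [act_b, tau_out, sig_Q]⟩).trans
    ((D.reach_Q_one n _).symm.trans (D.reach_Q_one n s))

theorem reach_e (n : ℕ) (q : D.Torus n) : D.Reach (T n q) (e n) :=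
  (D.reach_Q n q (D.z n)).trans ⟨FreeGroup.of D.b, fun κ => by rw [act_b, tau_z, sig_e]⟩

theorem reach_T (n : ℕ) (q : D.Torus n) : D.Reach (T 0 0) (T n q) := by
  induction n with
  | zero => exact D.reach_torus _ _ _
  | succ n ih =>
    refine ((ih 0).trans (D.reach_e n 0)).trans ?_
    refine Reach.trans ⟨FreeGroup.of D.b, fun κ => ?_⟩ (D.reach_torus _ (D.vec (n + 1) (0, 1)) q)
    rw [act_b, tau_e, sig_T, disp_b, zero_add]

/-- The actions are transitive, uniformly in the parameter. -/
theorem reach (x y : D.Pt) : D.Reach x y := by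
  have key (x : D.Pt) : D.Reach (T 0 0) x := by
    rcases x with ⟨n, q⟩ | ⟨n, s⟩ | n
    · exact D.reach_T n q
    · exact (D.reach_T n 0).trans (D.reach_Q n 0 s)
    · exact (D.reach_T n 0).trans (D.reach_e n 0)
  exact (key x).symm.trans (key y)

theorem ncard_image_symmDiff_le (n : ℕ) (i : ι) :
    ((D.act κ (FreeGroup.of i) '' Set.range (T n)) ∆ Set.range (T n)).ncard ≤ 4 := by
  have hsig : D.sig i '' Set.range (T n) = Set.range (T n) := by
    ext x
    constructor
    · rintro ⟨_, ⟨q, rfl⟩, rfl⟩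
      exact ⟨_, rfl⟩
    · rintro ⟨q, rfl⟩
      exact ⟨_, ⟨q - D.vec n (D.disp i), rfl⟩, by simp⟩
  by_cases hi : i = D.b
  · subst hi
    have h1 : D.act κ (FreeGroup.of D.b) '' Set.range (T n) =
        D.sig D.b '' (D.tau κ '' Set.range (T n)) := by
      rw [Set.image_image]
      exact Set.image_congr fun x _ => D.act_b κ x
    have h2 : (D.tau κ '' Set.range (T n)) ∆ Set.range (T n) ⊆
        {Q n (D.z n), D.prevOut n, T n (D.out n), T n 0} := by
      rintro x (⟨⟨_, ⟨q, rfl⟩, rfl⟩, hx⟩ | ⟨⟨q, rfl⟩, hx⟩)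
      · by_cases h1 : q = D.out n
        · subst h1; simp
        by_cases h2 : q = 0
        · subst h2; simp
        refine absurd ?_ hx
        by_cases h3 : q = D.dev κ n
        · subst h3; simp
        by_cases h4 : q = D.dev' κ n
        · subst h4; simp
        exact ⟨q, by simp [tau, tauFun, *]⟩
      · by_cases h1 : q = D.out n
        · subst h1; simp
        by_cases h2 : q = 0
        · subst h2; simp
        refine absurd ?_ hx
        by_cases h3 : q = D.dev κ n
        · subst h3; exact ⟨_, ⟨_, rfl⟩, D.tau_dev' κ n⟩
        by_cases h4 : q = D.dev' κ n
        · subst h4; exact ⟨_, ⟨_, rfl⟩, D.tau_dev κ n⟩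
        exact ⟨_, ⟨q, rfl⟩, by simp [tau, tauFun, *]⟩
    have h3 : (D.sig D.b '' (D.tau κ '' Set.range (T n))) ∆ Set.range (T n) =
        D.sig D.b '' ((D.tau κ '' Set.range (T n)) ∆ Set.range (T n)) := by
      rw [Set.image_symmDiff (D.sig D.b).injective, hsig]
    rw [h1, h3, Set.ncard_image_of_injective _ (D.sig D.b).injective]
    refine (Set.ncard_le_ncard h2 (Set.toFinite _)).trans ?_
    refine (Set.ncard_insert_le _ _).trans (Nat.succ_le_succ ?_)
    refine (Set.ncard_insert_le _ _).trans (Nat.succ_le_succ ?_)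
    refine (Set.ncard_insert_le _ _).trans (Nat.succ_le_succ ?_)
    simp
  · rw [act_of, gen_of_ne D κ hi, hsig]
    simp

theorem finite_range_T (n : ℕ) : (Set.range (T (D := D) n)).Finite := Set.finite_range _

theorem exists_ncard_image_symmDiff_le (g : FreeGroup ι) :
    ∃ C : ℕ, ∀ n, ((D.act κ g '' Set.range (T n)) ∆ Set.range (T n)).ncard ≤ C := by
  have key (g : FreeGroup ι) (n : ℕ) :
      ((D.act κ g⁻¹ '' Set.range (T n)) ∆ Set.range (T n)).ncard =
      ((D.act κ g '' Set.range (T n)) ∆ Set.range (T n)).ncard := by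
    rw [← Set.ncard_image_of_injective _ (D.act κ g).injective,
      Set.image_symmDiff (D.act κ g).injective, Set.image_image, symmDiff_comm]
    simp
  induction g using FreeGroup.induction_on with
  | C1 => exact ⟨0, by simp⟩
  | of i => exact ⟨4, fun n => D.ncard_image_symmDiff_le κ n i⟩
  | inv_of i _ => exact ⟨4, fun n => (key _ n).trans_le (D.ncard_image_symmDiff_le κ n i)⟩
  | mul g h hg hh =>
    obtain ⟨C, hC⟩ := hg
    obtain ⟨C', hC'⟩ := hh
    refine ⟨C' + C, fun n => ?_⟩
    have hfin := D.finite_range_T n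
    calc _ ≤ ((D.act κ g '' ((D.act κ h '' Set.range (T n)) ∆ Set.range (T n))) ∪
        ((D.act κ g '' Set.range (T n)) ∆ Set.range (T n))).ncard := by
          refine Set.ncard_le_ncard ?_ ?_
          · rw [Set.image_symmDiff (D.act κ g).injective, map_mul, Equiv.Perm.coe_mul,
              Set.image_comp]
            exact symmDiff_triangle _ _ _
          · exact ((((hfin.image _).symmDiff hfin).image _).union ((hfin.image _).symmDiff hfin))
      _ ≤ _ := Set.ncard_union_le _ _
      _ ≤ C' + C := by
        rw [Set.ncard_image_of_injective _ (D.act κ g).injective]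
        exact Nat.add_le_add (hC' n) (hC n)

theorem le_ncard_range_T (n : ℕ) : n ≤ (Set.range (T (D := D) n)).ncard := by
  have h : Function.Injective (T (D := D) n) := fun q q' h => by simpa using h
  rw [← Set.image_univ, Set.ncard_image_of_injective _ h, Set.ncard_univ, Nat.card_prod,
    Nat.card_zmod]
  have := D.L_large n
  nlinarith [Nat.zero_le (n ^ 2), Nat.zero_le (n ^ 3)]

/-- The actions are amenable. -/
theorem exists_folner (F : Finset (FreeGroup ι)) (ε : ℝ) (hε : 0 < ε) :
    ∃ A : Set D.Pt, A.Finite ∧ A.Nonempty ∧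
      ∀ g ∈ F, (((D.act κ g '' A) ∆ A).ncard : ℝ) < ε * A.ncard := by
  choose C hC using D.exists_ncard_image_symmDiff_le κ
  obtain ⟨n, hn⟩ := exists_nat_gt ((F.sup C : ℕ) / ε)
  refine ⟨_, D.finite_range_T n, Set.range_nonempty _, fun g hg => ?_⟩
  have h1 : ((C g : ℕ) : ℝ) ≤ (F.sup C : ℕ) := by exact_mod_cast Finset.le_sup hg
  have h2 : (n : ℝ) ≤ ((Set.range (T (D := D) n)).ncard : ℝ) := by exact_mod_cast D.le_ncard_range_T n
  have h3 : (((D.act κ g '' Set.range (T n)) ∆ Set.range (T n)).ncard : ℝ) ≤ C g := by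
    exact_mod_cast hC g n
  rw [div_lt_iff₀ hε] at hn
  nlinarith
/-- Far translations by the first generator are trivial on an initial part. -/
theorem act_a_zpow_of_lev_le {N : ℕ} (c : ℤ) {x : D.Pt} (hx : x.lev ≤ N) :
    D.act κ (FreeGroup.of D.a ^ (c * D.L (N + 1))) x = x := by
  have hdvd (m : ℕ) (hm : m ≤ N) : D.L (m + 1) ∣ D.L (N + 1) := by
    clear hx
    induction N, hm using Nat.le_induction with
    | base => exact dvd_rfl
    | succ k hk ih => exact ih.trans ((dvd_mul_left _ 4).trans (D.L_dvd (k + 1)))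
  rcases x with ⟨m, q⟩ | ⟨m, s⟩ | m
  · have h1 := (D.L_dvd m).trans (hdvd m hx)
    have h2 : D.vec m (c * D.L (N + 1), 0) = 0 := by
      rw [← vec_zero, vec_eq_iff]
      have : ((4 * D.L m : ℕ) : ℤ) ∣ D.L (N + 1) := Int.natCast_dvd_natCast.2 h1
      push_cast at this
      simp [Dvd.dvd.mul_left this]
    rw [act_a_zpow_T, h2, add_zero]
  · obtain ⟨k, hk⟩ := hdvd m hx
    have h1 (j : ℕ) : (D.sig D.a ^ j) (Q m s) = Q m ((D.σ D.a m ^ j) s) := by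
      induction j with
      | zero => rfl
      | succ j ih => rw [pow_succ', Equiv.Perm.mul_apply, ih, sig_Q, pow_succ', Equiv.Perm.mul_apply]
    have h2 : (D.sig D.a ^ D.L (N + 1)) (Q m s) = Q m s := by
      rw [h1, hk, pow_mul, D.σ_pow, one_pow, Equiv.Perm.one_apply]
    rw [map_zpow, act_of, gen_a, mul_comm, zpow_mul, zpow_natCast]
    exact Equiv.Perm.zpow_apply_eq_self_of_apply_eq_self h2 c
  · rw [map_zpow, act_of, gen_a]
    exact Equiv.Perm.zpow_apply_eq_self_of_apply_eq_self (D.sig_e _ _) _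

/-- The commutators used to compare the actions on an initial part and on the next torus. -/
def comm (k : ℤ) : FreeGroup ι :=
  (FreeGroup.of D.b)⁻¹ * FreeGroup.of D.a ^ k * FreeGroup.of D.b * FreeGroup.of D.a ^ (-k)

theorem lev_act_b_le {N : ℕ} {x : D.Pt} (hx : x.lev ≤ N) (hne : x ≠ e N) :
    (D.act κ (FreeGroup.of D.b) x).lev ≤ N := by
  rw [act_b, lev_sig]
  exact D.tau_lev κ hx hne

theorem act_comm_of_lev_le {N : ℕ} (c : ℤ) {x : D.Pt} (hx : x.lev ≤ N) (hne : x ≠ e N) :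
    D.act κ (D.comm (c * D.L (N + 1))) x = x := by
  rw [comm, ← neg_mul]
  simp only [map_mul, map_inv, Equiv.Perm.mul_apply, D.act_a_zpow_of_lev_le κ _ hx,
    D.act_a_zpow_of_lev_le κ _ (D.lev_act_b_le κ hx hne)]
  simp

theorem act_comm_e (N : ℕ) (k : ℤ) (c : ℤ) (hk : k = c * D.L (N + 1)) :
    D.act κ (D.comm k) (e N) = (D.tau κ)⁻¹ (T (N + 1) (D.vec (N + 1) (k, 0))) := by
  have h := D.act_a_zpow_of_lev_le κ (N := N) (-c) (x := e N) le_rfl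
  rw [neg_mul, ← hk] at h
  rw [comm]
  simp only [map_mul, map_inv, Equiv.Perm.mul_apply, h]
  rw [act_b, tau_e, sig_T, act_a_zpow_T, act_of, gen_b, mul_inv_rev, Equiv.Perm.mul_apply, sig_inv_T]
  congr 2
  abel

theorem act_comm_T (n : ℕ) (k : ℤ) (q q' : D.Torus n)
    (h : D.tau κ (T n (q - D.vec n (k, 0))) = T n q') :
    D.act κ (D.comm k) (T n q) = (D.tau κ)⁻¹ (T n (q' + D.vec n (k, 0))) := by
  have h1 : D.vec n (-k, 0) = - D.vec n (k, 0) := by rw [← vec_neg]; simp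
  rw [comm]
  simp only [map_mul, map_inv, Equiv.Perm.mul_apply]
  rw [act_a_zpow_T, h1, ← sub_eq_add_neg, act_b, h, sig_T, act_a_zpow_T, act_of, gen_b, mul_inv_rev,
    Equiv.Perm.mul_apply, sig_inv_T]
  congr 2
  abel

theorem tau_grid (n : ℕ) (c y : ℤ) (hc : 0 ≤ c ∧ c ≤ 3) (hcm : c ≠ mult κ n)
    (h : (c ≠ 0 ∧ y = 0) ∨ y = 1) :
    D.tau κ (T n (D.vec n (c * D.L n, y))) = T n (D.vec n (c * D.L n, y)) := by
  have hm := mult_cases κ n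
  refine D.tau_T_of_not_mem κ (D.vec_ne_out n _ _ (by rw [abs_le]; omega)) ?_
  rintro ⟨s, rfl | rfl | rfl, hs⟩
  · have := D.vec_eq_small (n := n) (x := 0) (y := 0) (x' := c) (y' := y) (by rw [← hs, zero_mul]; rfl)
      (by rw [abs_le]; omega) (by rw [abs_lt]; omega)
    omega
  · have := D.vec_eq_small (n := n) (x := mult κ n) (y := 0) (x' := c) (y' := y) (by rw [← hs]; rfl)
      (by rw [abs_le]; omega) (by rw [abs_lt]; omega)
    omega
  · have := D.vec_eq_small (n := n) (x := mult κ n) (y := 1) (x' := c) (y' := y)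
      (by rw [← hs]; simp [devZ])
      (by rw [abs_le]; omega) (by rw [abs_lt]; omega)
    omega

theorem tau_inv_grid (n : ℕ) (c y : ℤ) (hc : 0 ≤ c ∧ c ≤ 3) (hcm : c ≠ mult κ n)
    (h : (c ≠ 0 ∧ y = 0) ∨ y = 1) :
    (D.tau κ)⁻¹ (T n (D.vec n (c * D.L n, y))) = T n (D.vec n (c * D.L n, y)) := by
  rw [Equiv.Perm.inv_eq_iff_eq, D.tau_grid κ n c y hc hcm h]

theorem act_comm_one_e (N : ℕ) :
    D.act κ (D.comm (1 * D.L (N + 1))) (e N) = T (N + 1) (D.vec (N + 1) (1 * D.L (N + 1), 0)) := by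
  have hm := mult_cases κ (N + 1)
  rw [D.act_comm_e κ N _ 1 rfl, D.tau_inv_grid κ _ 1 0 (by omega) (by omega) (by omega)]

theorem act_comm_one_T (n : ℕ) :
    D.act κ (D.comm (1 * D.L n)) (T n (D.vec n (1 * D.L n, 1))) = T n (D.vec n (1 * D.L n, 1)) := by
  have hm := mult_cases κ n
  have h := D.tau_grid κ n 0 1 (by omega) (by omega) (by omega)
  rw [D.act_comm_T κ n _ _ (D.vec n (0 * D.L n, 1)) (by rw [← vec_sub]; simpa using h), ← vec_add]
  simpa using D.tau_inv_grid κ n 1 1 (by omega) (by omega) (by omega)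

theorem act_comm_dev (n : ℕ) (c : ℤ) (hc : c = 1 - mult κ n) :
    D.act κ (D.comm (c * D.L n)) (T n (D.vec n (1 * D.L n, 0))) = T n (D.vec n (1 * D.L n, 1)) := by
  have hm := mult_cases κ n
  have e1 : ((1 * D.L n, 0) : ℤ × ℤ) - (c * D.L n, 0) = D.devZ κ n := by
    subst hc; simp [devZ]; ring
  have e2 : D.devZ κ n + (0, 1) + (c * D.L n, 0) = ((1 * D.L n, 1) : ℤ × ℤ) := by
    subst hc; simp [devZ]; ring
  rw [D.act_comm_T κ n _ _ (D.dev' κ n) (by rw [← vec_sub, e1]; exact D.tau_dev κ n), dev',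
    ← vec_add, e2]
  exact D.tau_inv_grid κ n 1 1 (by omega) (by omega) (by omega)

theorem act_comm_dev' (n : ℕ) (c : ℤ) (hc : c = 1 - mult κ n) :
    D.act κ (D.comm (c * D.L n)) (T n (D.vec n (1 * D.L n, 1))) = T n (D.vec n (1 * D.L n, 0)) := by
  have hm := mult_cases κ n
  have e1 : ((1 * D.L n, 1) : ℤ × ℤ) - (c * D.L n, 0) = D.devZ κ n + (0, 1) := by
    subst hc; simp [devZ]; ring
  have e2 : D.devZ κ n + (c * D.L n, 0) = ((1 * D.L n, 0) : ℤ × ℤ) := by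
    subst hc; simp [devZ]; ring
  rw [D.act_comm_T κ n _ _ (D.dev κ n) (by rw [← vec_sub, e1]; exact D.tau_dev' κ n), dev,
    ← vec_add, e2]
  exact D.tau_inv_grid κ n 1 0 (by omega) (by omega) (by omega)

/-- Some group element acts on an initial part as a transposition. -/
theorem exists_act_swap (N : ℕ) : ∃ g : FreeGroup ι, D.act κ g (e N) = Q N (D.z N) ∧
    D.act κ g (Q N (D.z N)) = e N ∧
    ∀ x : D.Pt, x.lev ≤ N → x ≠ e N → x ≠ Q N (D.z N) → D.act κ g x = x := by
  set d := D.comm (1 * D.L (N + 1)) with hd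
  set S := D.comm ((1 - mult κ (N + 1)) * D.L (N + 1)) with hS
  set u := d * FreeGroup.of D.b * d with hu
  have hm := mult_cases κ (N + 1)
  have hz : D.act κ u (Q N (D.z N)) = T (N + 1) (D.vec (N + 1) (1 * D.L (N + 1), 0)) := by
    rw [hu]
    simp only [map_mul, Equiv.Perm.mul_apply]
    rw [hd, D.act_comm_of_lev_le κ (N := N) 1 (x := Q N (D.z N)) le_rfl (by simp), act_b, tau_z, sig_e,
      act_comm_one_e]
  have he : D.act κ u (e N) = T (N + 1) (D.vec (N + 1) (1 * D.L (N + 1), 1)) := by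
    rw [hu]
    simp only [map_mul, Equiv.Perm.mul_apply]
    rw [hd, act_comm_one_e, act_b, D.tau_grid κ _ 1 0 (by omega) (by omega) (by omega), sig_T,
      disp_b, ← vec_add]
    simpa using D.act_comm_one_T κ (N + 1)
  have key : ∀ x y : D.Pt, D.act κ S (D.act κ u x) = D.act κ u y → D.act κ (u⁻¹ * S * u) x = y := by
    intro x y h
    simp only [map_mul, map_inv, Equiv.Perm.mul_apply]
    rw [h]
    simp
  refine ⟨u⁻¹ * S * u, key _ _ ?_, key _ _ ?_, fun x hx h1 h2 => key _ _ ?_⟩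
  · rw [he, hz, hS, D.act_comm_dev' κ _ _ rfl]
  · rw [he, hz, hS, D.act_comm_dev κ _ _ rfl]
  · have h3 : D.act κ (FreeGroup.of D.b) x ≠ e N := by
      rw [act_b]
      intro h
      have h4 : D.tau κ x = D.tau κ (Q N (D.z N)) := by
        rw [tau_z]
        exact (D.sig D.b).injective (h.trans (D.sig_e _ _).symm)
      exact h2 ((D.tau κ).injective h4)
    have h4 := D.lev_act_b_le κ hx h1
    have h5 : D.act κ u x = D.act κ (FreeGroup.of D.b) x := by
      rw [hu]
      simp only [map_mul, Equiv.Perm.mul_apply]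
      rw [hd, D.act_comm_of_lev_le κ 1 hx h1, D.act_comm_of_lev_le κ 1 h4 h3]
    rw [h5, hS, D.act_comm_of_lev_le κ _ h4 h3]

/-- Some group element preserves an initial part, and agrees there with the second generator
wherever possible. -/
theorem exists_act_closing (N : ℕ) : ∃ g : FreeGroup ι,
    D.act κ g (e N) = D.sig D.b (T N (D.out N)) ∧
    ∀ x : D.Pt, x.lev ≤ N → x ≠ e N → D.act κ g x = D.act κ (FreeGroup.of D.b) x := by
  refine ⟨FreeGroup.of D.b * FreeGroup.of D.a ^ (-1 * (D.L (N + 1) : ℤ)) *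
    D.comm (1 * D.L (N + 1)), ?_, fun x hx hne => ?_⟩
  · simp only [map_mul, Equiv.Perm.mul_apply]
    rw [act_comm_one_e, act_a_zpow_T, ← vec_add, act_b]
    have : ((1 * D.L (N + 1), 0) : ℤ × ℤ) + (-1 * (D.L (N + 1) : ℤ), 0) = 0 := by simp
    rw [this, vec_zero, tau_zero]
    rfl
  · simp only [map_mul, Equiv.Perm.mul_apply]
    rw [D.act_comm_of_lev_le κ 1 hx hne, D.act_a_zpow_of_lev_le κ (-1) hx]

instance (N : ℕ) : Finite {x : D.Pt // x.lev ≤ N} := D.finite_lev_le N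

/-- The permutations of an initial part that are realized by group elements. -/
def realized (N : ℕ) : Subgroup (Equiv.Perm {x : D.Pt // x.lev ≤ N}) where
  carrier := {π | ∃ g, ∀ w : {x : D.Pt // x.lev ≤ N}, D.act κ g w = π w}
  one_mem' := ⟨1, by simp⟩
  mul_mem' := by
    rintro π ρ ⟨g, hg⟩ ⟨h, hh⟩
    exact ⟨g * h, fun w => by rw [map_mul, Equiv.Perm.mul_apply, hh, hg, Equiv.Perm.mul_apply]⟩
  inv_mem' := by
    rintro π ⟨g, hg⟩
    exact ⟨g⁻¹, fun w => by rw [map_inv, Equiv.Perm.inv_eq_iff_eq, hg]; simp⟩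

theorem exists_mem_realized {N : ℕ} {g : FreeGroup ι}
    (h : ∀ w : D.Pt, w.lev ≤ N → (D.act κ g w).lev ≤ N) :
    ∃ π ∈ D.realized κ N, ∀ w, (π w : D.Pt) = D.act κ g w := by
  let f : {x : D.Pt // x.lev ≤ N} → {x : D.Pt // x.lev ≤ N} := fun w => ⟨D.act κ g w, h w w.2⟩
  have hf : Function.Injective f := fun x y hxy =>
    Subtype.ext ((D.act κ g).injective (congrArg Subtype.val hxy))
  exact ⟨Equiv.ofBijective f (Finite.injective_iff_bijective.1 hf), ⟨g, fun w => rfl⟩, fun w => rfl⟩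

open Classical in
theorem swap_mem_realized (N : ℕ) (y : D.Pt) (hy : y.lev ≤ N) :
    Equiv.swap ⟨e N, le_rfl⟩ ⟨y, hy⟩ ∈ D.realized κ N := by
  set E : {x : D.Pt // x.lev ≤ N} := ⟨e N, le_rfl⟩ with hE
  set Z : {x : D.Pt // x.lev ≤ N} := ⟨Q N (D.z N), le_rfl⟩ with hZ
  set O : {x : D.Pt // x.lev ≤ N} := ⟨D.sig D.b (T N (D.out N)), le_rfl⟩ with hO
  have hconj {π : Equiv.Perm {x : D.Pt // x.lev ≤ N}} (hπ : π ∈ D.realized κ N)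
      {x y : {x : D.Pt // x.lev ≤ N}} (h : Equiv.swap x y ∈ D.realized κ N) :
      Equiv.swap (π x) (π y) ∈ D.realized κ N := by
    rw [Equiv.swap_apply_apply]
    exact mul_mem (mul_mem hπ h) (inv_mem hπ)
  have hEZ : Equiv.swap E Z ∈ D.realized κ N := by
    obtain ⟨g, h1, h2, h3⟩ := D.exists_act_swap κ N
    refine ⟨g, fun w => ?_⟩
    by_cases hw1 : w = E
    · subst hw1; rw [Equiv.swap_apply_left]; exact h1
    by_cases hw2 : w = Z
    · subst hw2; rw [Equiv.swap_apply_right]; exact h2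
    rw [Equiv.swap_apply_of_ne_of_ne hw1 hw2]
    exact h3 w w.2 (fun h => hw1 (Subtype.ext h)) (fun h => hw2 (Subtype.ext h))
  obtain ⟨g, hg1, hg2⟩ := D.exists_act_closing κ N
  obtain ⟨π, hπ, hπg⟩ := D.exists_mem_realized κ (N := N) (g := g) (fun w hw => by
    by_cases h : w = e N
    · rw [h, hg1]; exact le_rfl
    · rw [hg2 w hw h]; exact D.lev_act_b_le κ hw h)
  have hπE : π E = O := Subtype.ext (by rw [hπg]; exact hg1)
  have hπZ : π Z = E := Subtype.ext (by
    rw [hπg]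
    change D.act κ g (Q N (D.z N)) = e N
    rw [hg2 _ le_rfl (by simp), act_b, tau_z, sig_e])
  have hEO : Equiv.swap E O ∈ D.realized κ N := by
    have := hconj hπ hEZ
    rwa [hπE, hπZ, Equiv.swap_comm] at this
  let B : D.Pt → Prop := fun y => ∀ hy : y.lev ≤ N, Equiv.swap E ⟨y, hy⟩ ∈ D.realized κ N
  have hB0 : B (e N) := fun _ => by rw [← hE, Equiv.swap_self]; exact one_mem _
  have hgen (i : ι) (y : D.Pt) (hy : B y) : B (D.act κ (FreeGroup.of i) y) := by
    intro hiy
    by_cases hi : i = D.b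
    · subst hi
      by_cases hyN : y.lev ≤ N
      · have hne : y ≠ e N := by
          rintro rfl
          rw [act_b, tau_e] at hiy
          exact absurd hiy (Nat.not_succ_le_self N)
        have h1 := hconj hπ (hy hyN)
        have h2 : π ⟨y, hyN⟩ = ⟨D.act κ (FreeGroup.of D.b) y, hiy⟩ :=
          Subtype.ext (by rw [hπg]; exact hg2 y hyN hne)
        rw [hπE, h2] at h1
        exact SubmonoidClass.swap_mem_trans _ hEO h1
      · have h1 : D.tau κ y = T N (D.out N) := by
          by_contra h
          refine hyN ?_
          have h2 : (D.tau κ y).lev ≤ N := by rwa [act_b, lev_sig] at hiy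
          simpa using D.tau_inv_lev κ h2 h
        have h2 : (⟨D.act κ (FreeGroup.of D.b) y, hiy⟩ : {x : D.Pt // x.lev ≤ N}) = O :=
          Subtype.ext ((D.act_b κ y).trans (congrArg _ h1))
        rw [h2]
        exact hEO
    · have hact (w : D.Pt) : D.act κ (FreeGroup.of i) w = D.sig i w := by
        rw [act_of, gen_of_ne D κ hi]
      obtain ⟨ρ, hρ, hρg⟩ := D.exists_mem_realized κ (N := N) (g := FreeGroup.of i)
        (fun w hw => by rw [hact, lev_sig]; exact hw)
      have hyN : y.lev ≤ N := by rwa [hact, lev_sig] at hiy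
      have h1 := hconj hρ (hy hyN)
      have h2 : ρ ⟨y, hyN⟩ = ⟨D.act κ (FreeGroup.of i) y, hiy⟩ := Subtype.ext (hρg _)
      have h3 : ρ E = E := Subtype.ext (by rw [hρg, hact]; rfl)
      rwa [h2, h3] at h1
  have hpow (i : ι) (k : ℕ) (y : D.Pt) (hy : B y) : B (D.act κ (FreeGroup.of i ^ k) y) := by
    induction k with
    | zero => simpa using hy
    | succ k ih => rw [pow_succ', map_mul]; exact hgen i _ ih
  have hall (f : FreeGroup ι) : ∀ y, B y → B (D.act κ f y) := by
    induction f using FreeGroup.induction_on with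
    | C1 => intro y hy; simpa using hy
    | of i => exact hgen i
    | inv_of i _ =>
      intro y hy
      obtain ⟨m, hm1, hm⟩ := D.exists_pow_act_eq κ (FreeGroup.of i) y
      obtain ⟨k, rfl⟩ : ∃ k, m = k + 1 := ⟨m - 1, by omega⟩
      have : D.act κ (FreeGroup.of i)⁻¹ y = D.act κ (FreeGroup.of i ^ k) y := by
        rw [map_inv, Equiv.Perm.inv_eq_iff_eq, ← Equiv.Perm.mul_apply, ← map_mul, ← pow_succ', hm]
      rw [this]
      exact hpow i k y hy
    | mul f f' hf hf' =>
      intro y hy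
      rw [map_mul]
      exact hf _ (hf' _ hy)
  obtain ⟨f, hf⟩ := D.reach (e N) y
  exact (hf κ ▸ hall f _ hB0) hy

theorem realized_eq_top (N : ℕ) : D.realized κ N = ⊤ := by
  classical
  rw [eq_top_iff, ← Equiv.Perm.closure_isSwap, Subgroup.closure_le]
  rintro _ ⟨x, y, -, rfl⟩
  refine SubmonoidClass.swap_mem_trans (b := ⟨e N, le_rfl⟩) _ ?_ (D.swap_mem_realized κ N y y.2)
  rw [Equiv.swap_comm]
  exact D.swap_mem_realized κ N x x.2

/-- The actions are highly transitive. -/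
theorem exists_act_eq {k : ℕ} (x y : Fin k → D.Pt) (hx : Function.Injective x)
    (hy : Function.Injective y) : ∃ g, ∀ i, D.act κ g (x i) = y i := by
  obtain ⟨N, hN⟩ : ∃ N, ∀ i, (x i).lev ≤ N ∧ (y i).lev ≤ N := by
    refine ⟨Finset.univ.sup fun i => max (x i).lev (y i).lev, fun i => ?_⟩
    have := Finset.le_sup (f := fun i => max (x i).lev (y i).lev) (Finset.mem_univ i)
    exact max_le_iff.1 this
  let x' : Fin k ↪ {x : D.Pt // x.lev ≤ N} :=
    ⟨fun i => ⟨x i, (hN i).1⟩, fun i j h => hx (congrArg Subtype.val h)⟩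
  let y' : Fin k ↪ {x : D.Pt // x.lev ≤ N} :=
    ⟨fun i => ⟨y i, (hN i).2⟩, fun i j h => hy (congrArg Subtype.val h)⟩
  obtain ⟨π, hπ⟩ := (Equiv.Perm.isMultiplyPretransitive {x : D.Pt // x.lev ≤ N} k).exists_smul_eq x' y'
  obtain ⟨g, hg⟩ : π ∈ D.realized κ N := by rw [realized_eq_top]; trivial
  refine ⟨g, fun i => ?_⟩
  have h1 : π (x' i) = y' i := DFunLike.congr_fun hπ i
  exact (hg (x' i)).trans (congrArg Subtype.val h1)
end Data

section OrbitMeasure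

variable {G : Type*} [Group G]

theorem mem_conjSubgroup {γ g : G} {H : Subgroup G} : g ∈ conjSubgroup γ H ↔ γ⁻¹ * g * γ ∈ H := by
  constructor
  · rintro ⟨h, hh, rfl⟩
    simpa [mul_assoc] using hh
  · intro h
    exact ⟨_, h, by simp [mul_assoc]⟩

theorem conjSubgroup_conjSubgroup (γ δ : G) (H : Subgroup G) :
    conjSubgroup γ (conjSubgroup δ H) = conjSubgroup (γ * δ) H := by
  ext g
  simp [mem_conjSubgroup, mul_assoc]

theorem conjSubgroup_one (H : Subgroup G) : conjSubgroup 1 H = H := by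
  ext g
  simp [mem_conjSubgroup]

theorem conjSubgroup_injective (γ : G) : Function.Injective (conjSubgroup γ) := by
  intro H K h
  have := congrArg (conjSubgroup γ⁻¹) h
  simpa [conjSubgroup_conjSubgroup, conjSubgroup_one] using this

theorem measurableSet_mem (g : G) : MeasurableSet {H : Subgroup G | g ∈ H} :=
  MeasurableSpace.measurableSet_generateFrom ⟨g, rfl⟩

theorem measurable_conjSubgroup (γ : G) : Measurable (conjSubgroup γ) := by
  refine measurable_generateFrom ?_
  rintro _ ⟨g, rfl⟩
  have : conjSubgroup γ ⁻¹' {H | g ∈ H} = {H | γ⁻¹ * g * γ ∈ H} :=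
    Set.ext fun _ => mem_conjSubgroup
  rw [this]
  exact measurableSet_mem _

variable [Countable G]

instance : MeasurableSingletonClass (Subgroup G) where
  measurableSet_singleton H := by
    have : ({H} : Set (Subgroup G)) = ⋂ g : G, {K | g ∈ K ↔ g ∈ H} := by
      ext K
      simp [SetLike.ext_iff]
    rw [this]
    refine MeasurableSet.iInter fun g => ?_
    by_cases hg : g ∈ H
    · simpa [hg] using measurableSet_mem g
    · have hc : {K : Subgroup G | g ∈ K ↔ g ∈ H} = {K | g ∈ K}ᶜ := by
        ext K
        simp [hg]
      rw [hc]
      exact (measurableSet_mem g).compl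

/-- A probability measure supported on the conjugacy class of a subgroup. -/
noncomputable def orbitMeasure (H : Subgroup G) : Measure (Subgroup G) :=
  (Measure.sum fun γ : G => Measure.dirac (conjSubgroup γ H)).toFinite

theorem orbitMeasure_eq_zero_iff (H : Subgroup G) {B : Set (Subgroup G)} :
    orbitMeasure H B = 0 ↔ ∀ γ, conjSubgroup γ H ∉ B := by
  rw [orbitMeasure, toFinite_apply_eq_zero_iff, Measure.sum_apply_of_countable]
  simp [ENNReal.tsum_eq_zero, Set.indicator]

instance (H : Subgroup G) : IsProbabilityMeasure (orbitMeasure H) := by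
  have : NeZero (Measure.sum fun γ : G => Measure.dirac (conjSubgroup γ H)) := by
    refine ⟨fun h => ?_⟩
    have h1 := (orbitMeasure_eq_zero_iff H (B := Set.univ)).1 (by
      rw [orbitMeasure, toFinite_apply_eq_zero_iff, h]; rfl) 1
    exact h1 trivial
  unfold orbitMeasure
  infer_instance

theorem orbitMeasure_preimage (H : Subgroup G) (γ : G) (B : Set (Subgroup G)) :
    orbitMeasure H (conjSubgroup γ ⁻¹' B) = 0 ↔ orbitMeasure H B = 0 := by
  rw [orbitMeasure_eq_zero_iff, orbitMeasure_eq_zero_iff]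
  simp only [Set.mem_preimage, conjSubgroup_conjSubgroup]
  exact ((Group.mulLeft_bijective γ).surjective.forall
    (p := fun δ => conjSubgroup δ H ∉ B)).symm

theorem orbitMeasure_pos_iff (H : Subgroup G) {B : Set (Subgroup G)} :
    0 < orbitMeasure H B ↔ ∃ γ, conjSubgroup γ H ∈ B := by
  rw [pos_iff_ne_zero, Ne, orbitMeasure_eq_zero_iff]
  push Not
  rfl

theorem orbitMeasure_ergodic (H : Subgroup G) {B : Set (Subgroup G)} (hB : MeasurableSet B)
    (h : ∀ γ, orbitMeasure H ((conjSubgroup γ ⁻¹' B) ∆ B) = 0) :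
    orbitMeasure H B = 0 ∨ orbitMeasure H B = 1 := by
  have key (γ : G) : conjSubgroup γ H ∈ B ↔ H ∈ B := by
    have h1 := (orbitMeasure_eq_zero_iff H).1 (h γ) 1
    rw [conjSubgroup_one, Set.mem_symmDiff, Set.mem_preimage] at h1
    tauto
  by_cases hH : H ∈ B
  · right
    rw [← prob_compl_eq_zero_iff hB, orbitMeasure_eq_zero_iff]
    intro γ
    simp [key, hH]
  · left
    rw [orbitMeasure_eq_zero_iff]
    intro γ
    rwa [key]

theorem ae_orbitMeasure (H : Subgroup G) {p : Subgroup G → Prop} (h : ∀ γ, p (conjSubgroup γ H)) :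
    ∀ᵐ K ∂orbitMeasure H, p K := by
  rw [ae_iff, orbitMeasure_eq_zero_iff]
  simpa using h

theorem measurableSet_range_conjSubgroup (H : Subgroup G) :
    MeasurableSet (Set.range fun γ => conjSubgroup γ H) :=
  (Set.countable_range _).measurableSet

theorem orbitMeasure_compl_range (H : Subgroup G) :
    orbitMeasure H (Set.range fun γ => conjSubgroup γ H)ᶜ = 0 := by
  rw [orbitMeasure_eq_zero_iff]
  simp

/-- An invariant random subgroup does not charge an infinite conjugacy class. -/
theorem orbitMeasure_mutuallySingular (H : Subgroup G)
    (hinf : (Set.range fun γ => conjSubgroup γ H).Infinite) (ν : Measure (Subgroup G))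
    [IsProbabilityMeasure ν] (hν : ∀ γ, Measure.map (conjSubgroup γ) ν = ν) :
    orbitMeasure H ⟂ₘ ν := by
  have hconst (γ : G) : ν {conjSubgroup γ H} = ν {H} := by
    conv_lhs => rw [← hν γ]
    rw [Measure.map_apply (measurable_conjSubgroup γ) (measurableSet_singleton _)]
    congr 1
    ext K
    simp [(conjSubgroup_injective γ).eq_iff]
  have hzero : ν {H} = 0 := by
    by_contra h0
    let f := hinf.natEmbedding
    have hf (n : ℕ) : ν {(f n : Subgroup G)} = ν {H} := by
      obtain ⟨γ, hγ⟩ := (f n).2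
      rw [← hγ]
      exact hconst γ
    have h1 : ν (⋃ n, {(f n : Subgroup G)}) = ∑' n, ν {(f n : Subgroup G)} := by
      refine measure_iUnion (fun i j hij => ?_) fun n => measurableSet_singleton _
      simpa [Function.onFun, Subtype.ext_iff] using fun h => hij (f.injective (Subtype.ext h))
    simp only [hf] at h1
    rw [ENNReal.tsum_const_eq_top_of_ne_zero h0] at h1
    exact measure_ne_top _ _ h1
  refine ⟨(Set.range fun γ => conjSubgroup γ H)ᶜ, (measurableSet_range_conjSubgroup H).compl,
    orbitMeasure_compl_range H, ?_⟩
  rw [compl_compl, ← Set.iUnion_singleton_eq_range, measure_iUnion_null_iff]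
  intro γ
  rw [hconst, hzero]

theorem orbitMeasure_mutuallySingular_orbitMeasure (H K : Subgroup G)
    (h : ∀ γ, conjSubgroup γ H ≠ K) : orbitMeasure H ⟂ₘ orbitMeasure K := by
  refine ⟨(Set.range fun γ => conjSubgroup γ H)ᶜ, (measurableSet_range_conjSubgroup H).compl,
    orbitMeasure_compl_range H, ?_⟩
  rw [orbitMeasure_eq_zero_iff, compl_compl]
  rintro δ ⟨γ, hγ⟩
  refine h (δ⁻¹ * γ) ?_
  rw [← conjSubgroup_conjSubgroup]
  change conjSubgroup δ⁻¹ ((fun γ => conjSubgroup γ H) γ) = K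
  rw [hγ, conjSubgroup_conjSubgroup, inv_mul_cancel, conjSubgroup_one]

/-- A family of subgroups of a countable group indexed injectively by the Cantor space contains
continuum many pairwise non-conjugate members. -/
theorem exists_pairwise_not_conj (H : (ℕ → Bool) → Subgroup G) (hH : Function.Injective H) :
    ∃ f : Set.Icc (0 : ℝ) 1 → ℕ → Bool, ∀ s t, s ≠ t →
      ∀ γ, conjSubgroup γ (H (f s)) ≠ H (f t) := by
  let r : Setoid (ℕ → Bool) :=
    { r := fun κ κ' => ∃ γ, conjSubgroup γ (H κ) = H κ'
      iseqv :=
        { refl := fun κ => ⟨1, conjSubgroup_one _⟩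
          symm := by
            rintro κ κ' ⟨γ, hγ⟩
            exact ⟨γ⁻¹, by rw [← hγ, conjSubgroup_conjSubgroup, inv_mul_cancel, conjSubgroup_one]⟩
          trans := by
            rintro κ κ' κ'' ⟨γ, hγ⟩ ⟨γ', hγ'⟩
            exact ⟨γ' * γ, by rw [← conjSubgroup_conjSubgroup, hγ, hγ']⟩ } }
  have hmk (κ : ℕ → Bool) : ∃ γ, conjSubgroup γ (H (Quotient.mk r κ).out) = H κ := Quotient.mk_out κ
  choose γ hγ using hmk
  obtain ⟨c, hc⟩ := exists_injective_nat G
  have hle : Cardinal.mk (ℕ → Bool) ≤ Cardinal.mk (Quotient r × ℕ) := by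
    refine Cardinal.mk_le_of_injective (f := fun κ => (Quotient.mk r κ, c (γ κ))) ?_
    intro κ κ' h
    simp only [Prod.mk.injEq] at h
    apply hH
    rw [← hγ κ, ← hγ κ', h.1, hc h.2]
  have hcont : Cardinal.continuum ≤ Cardinal.mk (Quotient r) := by
    by_contra! hlt
    have h1 : Cardinal.mk (ℕ → Bool) = Cardinal.continuum := by simp
    rw [h1, Cardinal.mk_prod] at hle
    simp only [Cardinal.lift_id, Cardinal.mk_nat] at hle
    exact absurd hle (not_le.2 (Cardinal.mul_lt_of_lt Cardinal.aleph0_le_continuum hlt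
      Cardinal.aleph0_lt_continuum))
  rw [← Cardinal.mk_Icc_real (zero_lt_one' ℝ)] at hcont
  obtain ⟨f⟩ := hcont
  refine ⟨fun t => (f t).out, fun s t hst γ h => hst (f.injective ?_)⟩
  rw [← Quotient.out_equiv_out]
  exact ⟨γ, h⟩

end OrbitMeasure

section Stabilizer

variable {G X : Type*} [Group G] [MulAction G X] [MulAction.IsPretransitive G X]

/-- A transitive action is isomorphic to the action on the cosets of a point stabilizer. -/
theorem exists_equiv_quotient_stabilizer (x : X) :
    ∃ φ : G ⧸ MulAction.stabilizer G x ≃ X, ∀ (g : G) q, φ (g • q) = g • φ q := by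
  refine ⟨Equiv.ofBijective (MulAction.ofQuotientStabilizer G x)
    ⟨MulAction.injective_ofQuotientStabilizer G x, fun y => ?_⟩,
    MulAction.ofQuotientStabilizer_smul G x⟩
  obtain ⟨g, rfl⟩ := MulAction.exists_smul_eq G x y
  exact ⟨QuotientGroup.mk g, rfl⟩

theorem isCoreFree_stabilizer [FaithfulSMul G X] (x : X) : IsCoreFree (MulAction.stabilizer G x) := by
  intro h hh
  refine FaithfulSMul.eq_of_smul_eq_smul (α := X) fun y => ?_
  obtain ⟨g, rfl⟩ := MulAction.exists_smul_eq G x y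
  have := MulAction.mem_stabilizer_iff.1 (hh g)
  rw [one_smul]
  rwa [mul_assoc, mul_smul, inv_smul_eq_iff, mul_smul] at this

theorem isCoAmenable_stabilizer (x : X)
    (h : ∀ (F : Finset G) (ε : ℝ), 0 < ε → ∃ A : Set X, A.Finite ∧ A.Nonempty ∧
      ∀ g ∈ F, ((((g • ·) '' A) ∆ A).ncard : ℝ) < ε * A.ncard) :
    IsCoAmenable (MulAction.stabilizer G x) := by
  intro F ε hε
  obtain ⟨φ, hφ⟩ := exists_equiv_quotient_stabilizer (G := G) x
  obtain ⟨A, hA1, hA2, hA3⟩ := h F ε hε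
  refine ⟨φ.symm '' A, hA1.image _, hA2.image _, fun g hg => ?_⟩
  have h1 : (g • ·) '' (φ.symm '' A) = φ.symm '' ((g • ·) '' A) := by
    rw [Set.image_image, Set.image_image]
    refine Set.image_congr fun y _ => ?_
    rw [Equiv.eq_symm_apply, hφ, Equiv.apply_symm_apply]
  rw [h1, ← Set.image_symmDiff φ.symm.injective, Set.ncard_image_of_injective _ φ.symm.injective,
    Set.ncard_image_of_injective _ φ.symm.injective]
  exact hA3 g hg

theorem isCoHighlyTransitive_stabilizer (x : X)
    (h : ∀ (k : ℕ) (y z : Fin k → X), Function.Injective y → Function.Injective z →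
      ∃ g : G, ∀ i, g • y i = z i) :
    IsCoHighlyTransitive (MulAction.stabilizer G x) := by
  intro k _ y z hy hz
  obtain ⟨φ, hφ⟩ := exists_equiv_quotient_stabilizer (G := G) x
  obtain ⟨g, hg⟩ := h k (φ ∘ y) (φ ∘ z) (φ.injective.comp hy) (φ.injective.comp hz)
  exact ⟨g, fun i => φ.injective (by rw [hφ]; exact hg i)⟩

end Stabilizer

namespace Data

variable {ι : Type*} (D : Data ι) (κ : ℕ → Bool)

/-- The stabilizer of a point. -/
noncomputable def stab (x : D.Pt) : Subgroup (FreeGroup ι) :=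
  (MulAction.stabilizer (Equiv.Perm D.Pt) x).comap (D.act κ)

variable {D κ} in
theorem mem_stab {x : D.Pt} {g : FreeGroup ι} : g ∈ D.stab κ x ↔ D.act κ g x = x := Iff.rfl

theorem conjSubgroup_stab (γ : FreeGroup ι) (x : D.Pt) :
    conjSubgroup γ (D.stab κ x) = D.stab κ (D.act κ γ x) := by
  ext g
  rw [mem_conjSubgroup, mem_stab, mem_stab]
  simp only [map_mul, map_inv, Equiv.Perm.mul_apply]
  rw [Equiv.Perm.inv_eq_iff_eq]

theorem stab_properties (x : D.Pt) : IsCoreFree (D.stab κ x) ∧ IsCoAmenable (D.stab κ x) ∧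
    IsCoHighlyTransitive (D.stab κ x) := by
  let _ : MulAction (FreeGroup ι) D.Pt := MulAction.compHom D.Pt (D.act κ)
  have : MulAction.IsPretransitive (FreeGroup ι) D.Pt := ⟨fun x y => by
    obtain ⟨f, hf⟩ := D.reach x y
    exact ⟨f, hf κ⟩⟩
  have : FaithfulSMul (FreeGroup ι) D.Pt := ⟨fun h => D.act_injective κ (Equiv.ext h)⟩
  exact ⟨isCoreFree_stabilizer (G := FreeGroup ι) x,
    isCoAmenable_stabilizer (G := FreeGroup ι) x fun F ε hε => D.exists_folner κ F ε hε,
    isCoHighlyTransitive_stabilizer (G := FreeGroup ι) x fun k y z hy hz =>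
      D.exists_act_eq κ y z hy hz⟩

theorem infinite_pt : Infinite D.Pt :=
  Infinite.of_injective Pt.e fun m n h => by simpa using h

theorem stab_injective : Function.Injective (D.stab κ) := by
  intro x y h
  by_contra hxy
  have := D.infinite_pt
  obtain ⟨z, hz⟩ := (Set.toFinite {x, y}).exists_notMem
  rw [Set.mem_insert_iff, Set.mem_singleton_iff, not_or] at hz
  have hinj (w : D.Pt) (hw : w ≠ x) : Function.Injective ![x, w] := by
    intro i j hij
    fin_cases i <;> fin_cases j <;> simp_all [eq_comm]
  obtain ⟨g, hg⟩ := D.exists_act_eq κ ![x, y] ![x, z] (hinj y (Ne.symm hxy)) (hinj z hz.1)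
  have h1 : g ∈ D.stab κ x := hg 0
  rw [h] at h1
  exact hz.2 ((hg 1).symm.trans h1)

theorem infinite_range_conjSubgroup_stab (x : D.Pt) :
    (Set.range fun γ => conjSubgroup γ (D.stab κ x)).Infinite := by
  have := D.infinite_pt
  refine (Set.infinite_range_of_injective (D.stab_injective κ)).mono ?_
  rintro _ ⟨y, rfl⟩
  obtain ⟨f, hf⟩ := D.reach x y
  exact ⟨f, by simp only [conjSubgroup_stab, hf κ]⟩

theorem exists_conjSubgroup_pow_stab (γ : FreeGroup ι) (x : D.Pt) :
    ∃ n : ℕ, 1 ≤ n ∧ conjSubgroup (γ ^ n) (D.stab κ x) = D.stab κ x := by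
  obtain ⟨n, hn, h⟩ := D.exists_pow_act_eq κ γ x
  exact ⟨n, hn, by rw [conjSubgroup_stab, h]⟩

theorem act_b_two (n : ℕ) :
    D.act κ (FreeGroup.of D.b) (Pt.T n (D.vec n (2 * D.L n, 0))) =
      Pt.T n (D.vec n (2 * D.L n, 1)) ↔ κ n = true := by
  rw [act_b]
  by_cases h : κ n = true
  · have hm : mult κ n = 3 := by simp [mult, h]
    rw [D.tau_grid κ n 2 0 (by omega) (by omega) (by omega), sig_T, disp_b, ← vec_add]
    simp [h]
  · have hm : mult κ n = 2 := by simp [mult, h]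
    refine iff_of_false (fun h2 => ?_) h
    have h1 : D.vec n (2 * D.L n, 0) = D.dev κ n := by rw [dev, devZ, hm]
    rw [h1, tau_dev, sig_T, disp_b, dev', devZ, hm, ← vec_add] at h2
    simp only [Pt.T.injEq, heq_eq_eq, true_and] at h2
    have := D.vec_eq_small (n := n) (x := 2) (y := 2) (x' := 2) (y' := 1)
      (by rw [← h2]; congr 1) (by simp) (by simp)
    omega

theorem stab_injective_param (x : D.Pt) : Function.Injective fun κ => D.stab κ x := by
  intro κ κ' h
  funext n
  obtain ⟨f, hf⟩ := D.reach x (Pt.T n (D.vec n (2 * D.L n, 0)))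
  obtain ⟨f', hf'⟩ := D.reach x (Pt.T n (D.vec n (2 * D.L n, 1)))
  have key (κ : ℕ → Bool) : f'⁻¹ * FreeGroup.of D.b * f ∈ D.stab κ x ↔ κ n = true := by
    rw [mem_stab, ← D.act_b_two κ n]
    simp only [map_mul, map_inv, Equiv.Perm.mul_apply]
    rw [Equiv.Perm.inv_eq_iff_eq, hf, hf']
  rw [Bool.eq_iff_iff, ← key κ, ← key κ']
  simp only at h
  rw [h]

end Data

end ExoticECRS

/-- **Existence of exotic elementwise conservative random subgroups.**  Let `Γ = FreeGroup ι`
be a countable non-abelian free group (`ι` countable with at least two elements).  Then there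
is a family `(μ_t)_{t ∈ [0,1]}` of probability measures on `Sub(Γ)` such that (1) every
conjugation map is nonsingular for each `μ_t`; (2) every conjugation map is conservative for
each `μ_t`; (3) each `μ_t` is ergodic for the conjugation action; (4) `μ_t`-almost every
subgroup is core-free, co-amenable and co-highly transitive; (5) each `μ_t` is mutually
singular with every conjugation-invariant probability measure on `Sub(Γ)`; (6) the `μ_t` are
pairwise mutually singular. -/
theorem exotic_ECRS_exist {ι : Type*} [Countable ι] [Nontrivial ι] :
    ∃ μ : Set.Icc (0 : ℝ) 1 → Measure (Subgroup (FreeGroup ι)),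
      (∀ t, IsProbabilityMeasure (μ t)) ∧
      (∀ t (γ : FreeGroup ι) (B : Set (Subgroup (FreeGroup ι))), MeasurableSet B →
        (μ t (conjSubgroup γ ⁻¹' B) = 0 ↔ μ t B = 0)) ∧
      (∀ t (γ : FreeGroup ι) (B : Set (Subgroup (FreeGroup ι))), MeasurableSet B →
        0 < μ t B →
          ∃ n : ℕ, 1 ≤ n ∧ 0 < μ t {H | H ∈ B ∧ conjSubgroup (γ ^ n) H ∈ B}) ∧
      (∀ t (B : Set (Subgroup (FreeGroup ι))), MeasurableSet B →
        (∀ γ : FreeGroup ι, μ t ((conjSubgroup γ ⁻¹' B) ∆ B) = 0) →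
          μ t B = 0 ∨ μ t B = 1) ∧
      (∀ t, ∀ᵐ H ∂ μ t, IsCoreFree H ∧ IsCoAmenable H ∧ IsCoHighlyTransitive H) ∧
      (∀ t (ν : Measure (Subgroup (FreeGroup ι))), IsProbabilityMeasure ν →
        (∀ γ : FreeGroup ι, Measure.map (conjSubgroup γ) ν = ν) → μ t ⟂ₘ ν) ∧
      (∀ s t, s ≠ t → μ s ⟂ₘ μ t) := by
  obtain ⟨D⟩ := ExoticECRS.nonempty_data (ι := ι)
  let x : D.Pt := .e 0
  obtain ⟨f, hf⟩ := ExoticECRS.exists_pairwise_not_conj (fun κ => D.stab κ x)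
    (D.stab_injective_param x)
  refine ⟨fun t => ExoticECRS.orbitMeasure (D.stab (f t) x), fun t => inferInstance,
    fun t γ B _ => ExoticECRS.orbitMeasure_preimage _ γ B, fun t γ B _ hpos => ?_,
    fun t B hB h => ExoticECRS.orbitMeasure_ergodic _ hB h,
    fun t => ExoticECRS.ae_orbitMeasure _ fun γ => ?_,
    fun t ν _ hν => ExoticECRS.orbitMeasure_mutuallySingular _
      (D.infinite_range_conjSubgroup_stab (f t) x) ν hν,
    fun s t hst => ExoticECRS.orbitMeasure_mutuallySingular_orbitMeasure _ _ (hf s t hst)⟩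
  · obtain ⟨δ, hδ⟩ := (ExoticECRS.orbitMeasure_pos_iff _).1 hpos
    obtain ⟨n, hn, h⟩ := D.exists_conjSubgroup_pow_stab (f t) γ (D.act (f t) δ x)
    refine ⟨n, hn, (ExoticECRS.orbitMeasure_pos_iff _).2 ⟨δ, hδ, ?_⟩⟩
    rw [D.conjSubgroup_stab, h, ← D.conjSubgroup_stab]
    exact hδ
  · rw [D.conjSubgroup_stab]
    exact D.stab_properties (f t) _
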